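/- arXiv:2409.02623 — 2 statements merged into one kernel-verified Lean document; each statement's English description precedes it below -/
import Mathlib

section
/- Suppose α, β ∈ [-1/2, 1/2] and set ρ_α = α/2 + 1/4, ρ_β = β/2 + 1/4. Then the sequence n ↦ M_n(α,β) is monotonically increasing (M_{n+1}(α,β) ≥ M_n(α,β) for all n ∈ ℕ) and M_n(α,β) → 2^{1-ρ_α-ρ_β} as n → ∞; in particular M_n(α,β) ≤ 2^{1-ρ_α-ρ_β} for every n ∈ ℕ. -/
open Filter Real

/-- The Bernstein-type bound `M_n(α,β)` of Chow–Gatteschi–Wong, rewritten via Gamma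
functions. -/
noncomputable def chowBound (α β : ℝ) (n : ℕ) : ℝ :=
  (2 : ℝ) ^ (2 * (n : ℝ) + (α + β + 1) / 2) *
      Real.Gamma ((n : ℝ) + max α β + 1) * Real.Gamma ((n : ℝ) + α + β + 1) /
    (Real.sqrt Real.pi * ((n : ℝ) + (α + β + 1) / 2) ^ (max α β + 1 / 2) *
      Real.Gamma (2 * (n : ℝ) + α + β + 1))

/-- The weighted AM-GM estimate behind the monotonicity of `chowBound`. -/
lemma rpow_mul_le_quadratic {x c : ℝ} (hx : 0 < x) (hc0 : 0 ≤ c) (hc1 : c ≤ 1) :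
    x * (x + 1 / 2) * (x + 1) ^ c ≤ (x + c / 2) * (x + (c + 1) / 2) * x ^ c := by
  have h₁ := Real.geom_mean_le_arith_mean2_weighted (sub_nonneg.2 hc1) hc0 hx.le
    (by positivity : 0 ≤ x + 1 / 2) (by ring)
  have h₂ := Real.geom_mean_le_arith_mean2_weighted (sub_nonneg.2 hc1) hc0
    (by positivity : 0 ≤ x + 1 / 2) (by positivity : 0 ≤ x + 1) (by ring)
  have hxc : x ^ (1 - c) * x ^ c = x := by
    rw [← Real.rpow_add hx, sub_add_cancel, Real.rpow_one]
  have hyc : (x + 1 / 2) ^ c * (x + 1 / 2) ^ (1 - c) = x + 1 / 2 := by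
    rw [← Real.rpow_add (by positivity), add_sub_cancel, Real.rpow_one]
  calc x * (x + 1 / 2) * (x + 1) ^ c
      = (x ^ (1 - c) * (x + 1 / 2) ^ c) * ((x + 1 / 2) ^ (1 - c) * (x + 1) ^ c) * x ^ c := by
        linear_combination (-(x + 1 / 2) * (x + 1) ^ c) * hxc -
          x ^ (1 - c) * x ^ c * (x + 1) ^ c * hyc
    _ ≤ ((1 - c) * x + c * (x + 1 / 2)) * ((1 - c) * (x + 1 / 2) + c * (x + 1)) * x ^ c := by
        gcongr
    _ = (x + c / 2) * (x + (c + 1) / 2) * x ^ c := by ring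

lemma tendsto_natCast_div_natCast_add (a : ℝ) :
    Tendsto (fun n : ℕ => (n : ℝ) / (n + a)) atTop (nhds 1) := by
  simpa [add_comm] using tendsto_add_mul_div_add_mul_atTop_nhds (0 : ℝ) a 1 one_ne_zero

lemma GammaSeq_eq_Gamma_div {s : ℝ} (hs : 0 < s) (n : ℕ) :
    Real.GammaSeq s n = (n : ℝ) ^ s * n.factorial * Real.Gamma s / Real.Gamma (n + s + 1) := by
  have h : ∀ m : ℕ, Real.Gamma s * ∏ j ∈ Finset.range m, (s + j) = Real.Gamma (m + s) := by
    intro m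
    induction m with
    | zero => simp
    | succ m ih =>
      rw [Finset.prod_range_succ, ← mul_assoc, ih, Nat.cast_add_one,
        show (m : ℝ) + 1 + s = (m + s) + 1 by ring, Real.Gamma_add_one (by positivity)]
      ring
  have hG := (Real.Gamma_pos_of_pos hs).ne'
  have hn := h (n + 1)
  rw [Nat.cast_add_one, show (n : ℝ) + 1 + s = n + s + 1 by ring] at hn
  rw [Real.GammaSeq, ← hn]
  field_simp

/-- The asymptotics `Γ(n + s) ~ n ^ (s - 1) * n!`. -/
lemma tendsto_Gamma_natCast_add_div {s : ℝ} (hs : 0 ≤ s) :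
    Tendsto (fun n : ℕ => Real.Gamma (n + s) / ((n : ℝ) ^ (s - 1) * n.factorial)) atTop
      (nhds 1) := by
  have hG := (Real.Gamma_pos_of_pos (by positivity : 0 < s + 1)).ne'
  have h := ((tendsto_const_nhds (x := Real.Gamma (s + 1))).div
    (Real.GammaSeq_tendsto_Gamma (s + 1)) hG).mul
    ((tendsto_natCast_div_natCast_add s).mul (tendsto_natCast_div_natCast_add (s + 1)))
  rw [div_self hG, mul_one, mul_one] at h
  refine h.congr' ?_
  filter_upwards [eventually_gt_atTop 0] with n hn
  have hn' : (0 : ℝ) < n := by exact_mod_cast hn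
  have hg := Real.Gamma_pos_of_pos (by positivity : 0 < (n : ℝ) + s)
  have hp : (n : ℝ) ^ (s + 1) = (n : ℝ) ^ (s - 1) * n ^ 2 := by
    rw [← Real.rpow_natCast, ← Real.rpow_add hn']
    congr 1
    push_cast
    ring
  rw [Pi.div_apply, GammaSeq_eq_Gamma_div (by positivity), hp,
    show (n : ℝ) + (s + 1) + 1 = (n + s + 1) + 1 by ring,
    Real.Gamma_add_one (s := n + s + 1) (by positivity),
    Real.Gamma_add_one (s := n + s) (by positivity), ← add_assoc]
  field_simp

lemma chowBound_succ {α β : ℝ} {n : ℕ} (hq : 0 < (n : ℝ) + max α β + 1)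
    (hs : 0 < (n : ℝ) + α + β + 1) :
    chowBound α β (n + 1) = chowBound α β n *
      (((n : ℝ) + max α β + 1) * ((n : ℝ) + α + β + 1) *
          ((n : ℝ) + (α + β + 1) / 2) ^ (max α β + 1 / 2) /
        (((n : ℝ) + (α + β + 1) / 2) * ((n : ℝ) + (α + β + 1) / 2 + 1 / 2) *
          ((n : ℝ) + (α + β + 1) / 2 + 1) ^ (max α β + 1 / 2))) := by
  have hN : 0 < (n : ℝ) + (α + β + 1) / 2 := by linarith [n.cast_nonneg (α := ℝ)]
  have h2 : 0 < 2 * (n : ℝ) + α + β + 1 := by linarith [n.cast_nonneg (α := ℝ)]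
  have hΓ := Real.Gamma_pos_of_pos h2
  have hpow : (2 : ℝ) ^ (2 * ((n : ℝ) + 1) + (α + β + 1) / 2) =
      (2 : ℝ) ^ (2 * (n : ℝ) + (α + β + 1) / 2) * 4 := by
    rw [show 2 * ((n : ℝ) + 1) + (α + β + 1) / 2 = (2 * n + (α + β + 1) / 2) + (2 : ℕ) by
      push_cast; ring, Real.rpow_add two_pos, Real.rpow_natCast]
    norm_num
  have e₁ : (n : ℝ) + 1 + max α β + 1 = (n + max α β + 1) + 1 := by ring
  have e₂ : (n : ℝ) + 1 + α + β + 1 = (n + α + β + 1) + 1 := by ring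
  have e₃ : 2 * ((n : ℝ) + 1) + α + β + 1 = (2 * n + α + β + 1) + 1 + 1 := by ring
  have e₄ : (n : ℝ) + 1 + (α + β + 1) / 2 = (n + (α + β + 1) / 2) + 1 := by ring
  have e₅ : 2 * (n : ℝ) + α + β + 1 = 2 * (n + (α + β + 1) / 2) := by ring
  unfold chowBound
  rw [Nat.cast_add_one, hpow, e₁, e₂, e₃, e₄, Real.Gamma_add_one hq.ne',
    Real.Gamma_add_one hs.ne', Real.Gamma_add_one (add_pos h2 one_pos).ne', Real.Gamma_add_one h2.ne']
  rw [e₅] at hΓ ⊢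
  generalize (n : ℝ) + (α + β + 1) / 2 = x at *
  have hx : 0 < x ^ (max α β + 1 / 2) := Real.rpow_pos_of_pos hN _
  have hx1 : 0 < (x + 1) ^ (max α β + 1 / 2) := Real.rpow_pos_of_pos (by positivity) _
  field_simp
  ring

lemma chowBound_nonneg {α β : ℝ} (hα : -1 / 2 ≤ α) (hβ : -1 / 2 ≤ β) (n : ℕ) :
    0 ≤ chowBound α β n := by
  have hn : (0 : ℝ) ≤ n := n.cast_nonneg
  have hq : α ≤ max α β := le_max_left α β
  have h₁ := Real.Gamma_nonneg_of_nonneg (by linarith : 0 ≤ (n : ℝ) + max α β + 1)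
  have h₂ := Real.Gamma_nonneg_of_nonneg (by linarith : 0 ≤ (n : ℝ) + α + β + 1)
  have h₃ := Real.Gamma_nonneg_of_nonneg (by linarith : 0 ≤ 2 * (n : ℝ) + α + β + 1)
  have h₄ : 0 ≤ (n : ℝ) + (α + β + 1) / 2 := by linarith
  unfold chowBound
  positivity

lemma chowBound_le_succ {α β : ℝ} (hα : α ∈ Set.Icc (-(1 : ℝ) / 2) (1 / 2))
    (hβ : β ∈ Set.Icc (-(1 : ℝ) / 2) (1 / 2)) (n : ℕ) :
    chowBound α β n ≤ chowBound α β (n + 1) := by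
  have h0 := chowBound_nonneg hα.1 hβ.1
  have hn : (0 : ℝ) ≤ n := n.cast_nonneg
  have hq0 : -1 / 2 ≤ max α β := hα.1.trans (le_max_left α β)
  have hq1 : max α β ≤ 1 / 2 := max_le hα.2 hβ.2
  have hp0 : -1 / 2 ≤ min α β := le_min hα.1 hβ.1
  have hp1 : min α β ≤ 1 / 2 := (min_le_left α β).trans hα.2
  have hsum := max_add_min α β
  rcases (by linarith [hα.1, hβ.1] : 0 ≤ (n : ℝ) + α + β + 1).eq_or_lt with hs | hs
  · have : chowBound α β n = 0 := by simp [chowBound, ← hs]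
    exact this ▸ h0 _
  rw [chowBound_succ (by linarith) hs]
  refine le_mul_of_one_le_right (h0 n) ?_
  have hN : 0 < (n : ℝ) + (α + β + 1) / 2 := by linarith
  have e₁ : (n : ℝ) + max α β + 1 =
      (n + (α + β + 1) / 2) + (max α β - min α β + 1) / 2 := by linarith
  have e₂ : (n : ℝ) + α + β + 1 = (n + (α + β + 1) / 2) + (max α β + min α β + 1) / 2 := by
    linarith
  rw [e₁, e₂, one_le_div (by positivity)]
  refine (rpow_mul_le_quadratic hN (by linarith) (by linarith)).trans ?_
  refine mul_le_mul_of_nonneg_right ?_ (by positivity)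
  nlinarith [mul_nonneg (sub_nonneg.2 hp0) (sub_nonneg.2 hp1)]

/-- Legendre duplication removes the factor `Γ(2n + α + β + 1)` from `chowBound`. -/
lemma chowBound_eq {α β : ℝ} {n : ℕ} (hs : 0 < 2 * (n : ℝ) + α + β + 1) :
    chowBound α β n = (2 : ℝ) ^ (1 - (α / 2 + 1 / 4) - (β / 2 + 1 / 4)) *
      (Real.Gamma (n + (max α β + 1)) * Real.Gamma (n + (α + β + 1)) /
        (((n : ℝ) + (α + β + 1) / 2) ^ (max α β + 1 / 2) *
          (Real.Gamma (n + (α + β + 1) / 2) * Real.Gamma (n + ((α + β + 1) / 2 + 1 / 2))))) := by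
  have hd := Real.Gamma_mul_Gamma_add_half ((n : ℝ) + (α + β + 1) / 2)
  rw [show 2 * ((n : ℝ) + (α + β + 1) / 2) = 2 * n + α + β + 1 by ring] at hd
  have hN : 0 < (n : ℝ) + (α + β + 1) / 2 := by linarith
  have hΓ := Real.Gamma_pos_of_pos hs
  have hp : (2 : ℝ) ^ (2 * (n : ℝ) + (α + β + 1) / 2) *
      (2 : ℝ) ^ (1 - (2 * (n : ℝ) + α + β + 1)) =
      (2 : ℝ) ^ (1 - (α / 2 + 1 / 4) - (β / 2 + 1 / 4)) := by
    rw [← Real.rpow_add two_pos]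
    congr 1
    ring
  simp only [← add_assoc] at hd ⊢
  rw [hd, ← hp, chowBound]
  have hx : 0 < ((n : ℝ) + (α + β + 1) / 2) ^ (max α β + 1 / 2) := Real.rpow_pos_of_pos hN _
  field_simp

lemma tendsto_chowBound {α β : ℝ} (hα : -1 / 2 ≤ α) (hβ : -1 / 2 ≤ β) :
    Tendsto (fun n : ℕ => chowBound α β n) atTop
      (nhds ((2 : ℝ) ^ (1 - (α / 2 + 1 / 4) - (β / 2 + 1 / 4)))) := by
  have hq : α ≤ max α β := le_max_left α β
  have hG := ((tendsto_Gamma_natCast_add_div (by linarith : 0 ≤ max α β + 1)).mul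
    (tendsto_Gamma_natCast_add_div (by linarith : 0 ≤ α + β + 1))).div
    ((tendsto_Gamma_natCast_add_div (by linarith : 0 ≤ (α + β + 1) / 2)).mul
    (tendsto_Gamma_natCast_add_div (by linarith : 0 ≤ (α + β + 1) / 2 + 1 / 2))) (by norm_num)
  have h := ((hG.mul ((tendsto_natCast_div_natCast_add ((α + β + 1) / 2)).rpow_const
    (p := max α β + 1 / 2) (Or.inl one_ne_zero))).const_mul
    ((2 : ℝ) ^ (1 - (α / 2 + 1 / 4) - (β / 2 + 1 / 4))))
  simp only [mul_one, div_one, Real.one_rpow] at h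
  refine h.congr' ?_
  filter_upwards [eventually_gt_atTop 0] with n hn
  have hn' : (0 : ℝ) < n := by exact_mod_cast hn
  have hN : 0 < (n : ℝ) + (α + β + 1) / 2 := by linarith
  rw [chowBound_eq (by linarith), Real.div_rpow hn'.le hN.le]
  congr 1
  have hp : (n : ℝ) ^ (max α β + 1 - 1) * (n : ℝ) ^ (α + β + 1 - 1) *
      (n : ℝ) ^ (-(max α β + 1 / 2)) =
      (n : ℝ) ^ ((α + β + 1) / 2 - 1) * (n : ℝ) ^ ((α + β + 1) / 2 + 1 / 2 - 1) := by
    simp only [← Real.rpow_add hn']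
    congr 1
    ring
  rw [Real.rpow_neg hn'.le] at hp
  have h₁ := Real.Gamma_pos_of_pos hN
  have h₂ := Real.Gamma_pos_of_pos (by linarith : 0 < (n : ℝ) + ((α + β + 1) / 2 + 1 / 2))
  have hc : 0 < (n : ℝ) ^ (max α β + 1 / 2) := Real.rpow_pos_of_pos hn' _
  have hNc : 0 < ((n : ℝ) + (α + β + 1) / 2) ^ (max α β + 1 / 2) := Real.rpow_pos_of_pos hN _
  have hA : 0 < (n : ℝ) ^ (max α β + 1 - 1) := Real.rpow_pos_of_pos hn' _
  have hB : 0 < (n : ℝ) ^ (α + β + 1 - 1) := Real.rpow_pos_of_pos hn' _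
  have hC : 0 < (n : ℝ) ^ ((α + β + 1) / 2 - 1) := Real.rpow_pos_of_pos hn' _
  have hD : 0 < (n : ℝ) ^ ((α + β + 1) / 2 + 1 / 2 - 1) := Real.rpow_pos_of_pos hn' _
  have hf : (0 : ℝ) < n.factorial := by exact_mod_cast n.factorial_pos
  rw [Pi.div_apply]
  generalize (n : ℝ) ^ (max α β + 1 - 1) = A at *
  generalize (n : ℝ) ^ (α + β + 1 - 1) = B at *
  generalize (n : ℝ) ^ ((α + β + 1) / 2 - 1) = C at *
  generalize (n : ℝ) ^ ((α + β + 1) / 2 + 1 / 2 - 1) = D at *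
  generalize (n : ℝ) ^ (max α β + 1 / 2) = E at *
  generalize ((n : ℝ) + (α + β + 1) / 2) ^ (max α β + 1 / 2) = F at *
  generalize Real.Gamma ((n : ℝ) + (α + β + 1) / 2) = G at *
  generalize Real.Gamma ((n : ℝ) + ((α + β + 1) / 2 + 1 / 2)) = H at *
  generalize Real.Gamma ((n : ℝ) + (max α β + 1)) = I at *
  generalize Real.Gamma ((n : ℝ) + (α + β + 1)) = J at *
  have hE : A * B = C * D * E := by
    rw [← hp]
    field_simp
  field_simp
  linear_combination (-(I * J)) * hE

theorem chowBound_monotone_tendsto (α β : ℝ)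
    (hα : α ∈ Set.Icc (-(1 : ℝ) / 2) (1 / 2)) (hβ : β ∈ Set.Icc (-(1 : ℝ) / 2) (1 / 2)) :
    (∀ n : ℕ, chowBound α β n ≤ chowBound α β (n + 1)) ∧
      Tendsto (fun n : ℕ => chowBound α β n) atTop
        (nhds ((2 : ℝ) ^ (1 - (α / 2 + 1 / 4) - (β / 2 + 1 / 4)))) ∧
      ∀ n : ℕ, chowBound α β n ≤ (2 : ℝ) ^ (1 - (α / 2 + 1 / 4) - (β / 2 + 1 / 4)) := by
  have hmono : Monotone (chowBound α β) := monotone_nat_of_le_succ (chowBound_le_succ hα hβ)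
  have hlim := tendsto_chowBound hα.1 hβ.1
  exact ⟨chowBound_le_succ hα hβ, hlim, hmono.ge_of_tendsto hlim⟩
end

section
/- If 0 ≤ ρ_α, ρ_β ≤ 1/2 and r = 2·max(ρ_α, ρ_β), then for every n ≥ 1, 𝒲_n(ρ_α,ρ_β) ≤ 2^{2n+ρ_α+ρ_β} Γ(n+r+1/2) Γ(n+2ρ_α+2ρ_β) / ( √π · (n+ρ_α+ρ_β)^r · Γ(2n+2ρ_α+2ρ_β) ) ≤ 2^{1-ρ_α-ρ_β}, and the rightmost inequality is strict unless ρ_α ∈ {0, 1/2} and ρ_β ∈ {0, 1/2}. -/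
/-- The weighted sup `sup_{x ∈ [-1,1]} (1-x)^ρα (1+x)^ρβ |P(x)|`. -/
noncomputable def jacobiSup (ρa ρb : ℝ) (P : Polynomial ℝ) : ℝ :=
  sSup ((fun x : ℝ => (1 - x) ^ ρa * (1 + x) ^ ρb * |P.eval x|) '' Set.Icc (-1 : ℝ) 1)

/-- The Widom factor `𝒲_n(ρα, ρβ)` for the Jacobi weight `(1-x)^ρα (1+x)^ρβ` on `[-1,1]`. -/
noncomputable def widomFactor (ρa ρb : ℝ) (n : ℕ) : ℝ :=
  2 ^ n * sInf (jacobiSup ρa ρb '' {P : Polynomial ℝ | P.Monic ∧ P.natDegree = n})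

open Set Filter Topology

/-- `U` solves `U'' + φ U = 0` on `s`, where `φ₁ = φ'`, `φ₂ = φ''`, `U₁ = U'`, and `φ > 0` is such
that `φ ^ (-1/2)` is strictly concave. -/
structure IsOscillator (φ φ₁ φ₂ U U₁ : ℝ → ℝ) (s : Set ℝ) : Prop where
  pos : ∀ t ∈ s, 0 < φ t
  hasDerivAt_phi : ∀ t ∈ s, HasDerivAt φ (φ₁ t) t
  hasDerivAt_phi₁ : ∀ t ∈ s, HasDerivAt φ₁ (φ₂ t) t
  hasDerivAt_U : ∀ t ∈ s, HasDerivAt U (U₁ t) t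
  hasDerivAt_U₁ : ∀ t ∈ s, HasDerivAt U₁ (-(φ t * U t)) t
  concave : ∀ t ∈ s, 3 * φ₁ t ^ 2 < 2 * φ t * φ₂ t

/-- The Sonin function of an oscillator. -/
noncomputable def sonin (φ U U₁ : ℝ → ℝ) (t : ℝ) : ℝ := U t ^ 2 + U₁ t ^ 2 / φ t

/-- The Sonin function times the relative angular speed of the Prüfer phase. -/
noncomputable def soninTwist (φ φ₁ U U₁ : ℝ → ℝ) (t : ℝ) : ℝ :=
  sonin φ U U₁ t + φ₁ t * U t * U₁ t / (2 * φ t ^ 2)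

/-- The derivative of `φ ^ (-1/2)`. -/
noncomputable def slowness (φ φ₁ : ℝ → ℝ) (t : ℝ) : ℝ := -φ₁ t / (2 * (φ t * √(φ t)))

/-- The angular speed of the Prüfer phase. -/
noncomputable def phaseSpeed (φ φ₁ U U₁ : ℝ → ℝ) (t : ℝ) : ℝ :=
  √(φ t) * soninTwist φ φ₁ U U₁ t / sonin φ U U₁ t

/-- The cosine of the Prüfer phase. -/
noncomputable def phaseCos (φ U U₁ : ℝ → ℝ) (t : ℝ) : ℝ := U t / √(sonin φ U U₁ t)

/-- The sine of the Prüfer phase. -/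
noncomputable def phaseSin (φ U U₁ : ℝ → ℝ) (t : ℝ) : ℝ :=
  -U₁ t / (√(φ t) * √(sonin φ U U₁ t))

namespace IsOscillator

variable {φ φ₁ φ₂ U U₁ : ℝ → ℝ} {s : Set ℝ} {t l r : ℝ}

theorem mono {s' : Set ℝ} (h : IsOscillator φ φ₁ φ₂ U U₁ s) (hs : s' ⊆ s) :
    IsOscillator φ φ₁ φ₂ U U₁ s' :=
  ⟨fun t ht => h.pos t (hs ht), fun t ht => h.hasDerivAt_phi t (hs ht),
    fun t ht => h.hasDerivAt_phi₁ t (hs ht), fun t ht => h.hasDerivAt_U t (hs ht),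
    fun t ht => h.hasDerivAt_U₁ t (hs ht), fun t ht => h.concave t (hs ht)⟩

theorem hasDerivAt_sonin (h : IsOscillator φ φ₁ φ₂ U U₁ s) (ht : t ∈ s) :
    HasDerivAt (sonin φ U U₁) (-(φ₁ t * U₁ t ^ 2 / φ t ^ 2)) t := by
  have hp := (h.pos t ht).ne'
  have := ((h.hasDerivAt_U t ht).pow 2).add
    (((h.hasDerivAt_U₁ t ht).pow 2).div (h.hasDerivAt_phi t ht) hp)
  refine this.congr_deriv ?_
  simp only [Pi.pow_apply]
  field_simp
  ring

theorem hasDerivAt_soninTwist (h : IsOscillator φ φ₁ φ₂ U U₁ s) (ht : t ∈ s) :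
    HasDerivAt (soninTwist φ φ₁ U U₁)
      (-(φ₁ t / (2 * φ t)) * soninTwist φ φ₁ U U₁ t +
        U t * U₁ t * (2 * φ t * φ₂ t - 3 * φ₁ t ^ 2) / (4 * φ t ^ 3)) t := by
  have hp := (h.pos t ht).ne'
  have := (h.hasDerivAt_sonin ht).add
    ((((h.hasDerivAt_phi₁ t ht).mul (h.hasDerivAt_U t ht)).mul (h.hasDerivAt_U₁ t ht)).div
      (((h.hasDerivAt_phi t ht).pow 2).const_mul 2) (by simpa using hp))
  refine this.congr_deriv ?_
  simp only [Pi.pow_apply, Pi.mul_apply, soninTwist, sonin]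
  field_simp
  ring

theorem hasDerivAt_slowness (h : IsOscillator φ φ₁ φ₂ U U₁ s) (ht : t ∈ s) :
    HasDerivAt (slowness φ φ₁)
      ((3 * φ₁ t ^ 2 - 2 * φ t * φ₂ t) / (4 * φ t ^ 2 * √(φ t))) t := by
  have hp := h.pos t ht
  have hs : 0 < √(φ t) := Real.sqrt_pos.2 hp
  have hsq : √(φ t) ^ 2 = φ t := Real.sq_sqrt hp.le
  have := ((h.hasDerivAt_phi₁ t ht).neg).div
    (((h.hasDerivAt_phi t ht).mul ((h.hasDerivAt_phi t ht).sqrt hp.ne')).const_mul 2)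
    (by simp only [Pi.mul_apply]; positivity)
  refine this.congr_deriv ?_
  simp only [Pi.mul_apply, Pi.neg_apply]
  generalize √(φ t) = p at *
  rw [← hsq]
  field_simp
  ring

theorem sonin_monotoneOn (h : IsOscillator φ φ₁ φ₂ U U₁ (Icc l r))
    (hφ : ∀ t ∈ Icc l r, φ₁ t ≤ 0) : MonotoneOn (sonin φ U U₁) (Icc l r) := by
  refine monotoneOn_of_hasDerivWithinAt_nonneg (convex_Icc l r)
    (fun t ht => (h.hasDerivAt_sonin ht).continuousAt.continuousWithinAt)
    (fun t ht => (h.hasDerivAt_sonin (interior_subset ht)).hasDerivWithinAt) (fun t ht => ?_)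
  have h1 := hφ t (interior_subset ht)
  rw [← neg_div, ← neg_mul]
  exact div_nonneg (mul_nonneg (by linarith) (sq_nonneg _)) (sq_nonneg _)

theorem sonin_pos (h : IsOscillator φ φ₁ φ₂ U U₁ (Icc l r))
    (hφ : ∀ t ∈ Icc l r, φ₁ t ≤ 0) (hU : U l ≠ 0) (ht : t ∈ Icc l r) :
    0 < sonin φ U U₁ t := by
  have hl : l ∈ Icc l r := left_mem_Icc.2 (ht.1.trans ht.2)
  refine lt_of_lt_of_le ?_ (h.sonin_monotoneOn hφ hl ht ht.1)
  have := h.pos l hl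
  unfold sonin
  positivity

theorem soninTwist_pos (h : IsOscillator φ φ₁ φ₂ U U₁ (Icc l r))
    (hφ : ∀ t ∈ Icc l r, φ₁ t ≤ 0) (hU : U l ≠ 0) (hU₁ : U₁ l = 0)
    (ht : t ∈ Icc l r) : 0 < soninTwist φ φ₁ U U₁ t := by
  have key : ∀ x ∈ Icc l r, soninTwist φ φ₁ U U₁ x = 0 →
      0 < -(φ₁ x / (2 * φ x)) * soninTwist φ φ₁ U U₁ x +
        U x * U₁ x * (2 * φ x * φ₂ x - 3 * φ₁ x ^ 2) / (4 * φ x ^ 3) := by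
    intro x hx h0
    have hp := h.pos x hx
    have hf := h.sonin_pos hφ hU hx
    have hc := h.concave x hx
    have h1 : φ₁ x * U x * U₁ x / (2 * φ x ^ 2) < 0 := by
      unfold soninTwist at h0; linarith
    have h2 : φ₁ x * (U x * U₁ x) < 0 := by
      by_contra hcon
      push Not at hcon
      have : 0 ≤ φ₁ x * U x * U₁ x / (2 * φ x ^ 2) := by
        rw [mul_assoc]; positivity
      linarith
    have h3 : 0 < U x * U₁ x := by
      have := hφ x hx
      by_contra hcon
      push Not at hcon
      have := mul_nonneg_of_nonpos_of_nonpos this hcon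
      linarith
    rw [h0, mul_zero, zero_add]
    have : 0 < 2 * φ x * φ₂ x - 3 * φ₁ x ^ 2 := by linarith
    positivity
  have hnn : ∀ x ∈ Icc l r, 0 ≤ soninTwist φ φ₁ U U₁ x := by
    intro x hx
    have hl : l ∈ Icc l r := left_mem_Icc.2 (ht.1.trans ht.2)
    have := image_le_of_deriv_right_lt_deriv_boundary' (f := fun _ => 0) (f' := fun _ => 0)
      (B := soninTwist φ φ₁ U U₁)
      (B' := fun x => -(φ₁ x / (2 * φ x)) * soninTwist φ φ₁ U U₁ x +
        U x * U₁ x * (2 * φ x * φ₂ x - 3 * φ₁ x ^ 2) / (4 * φ x ^ 3))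
      continuousOn_const (fun x _ => hasDerivWithinAt_const _ _ _)
      (by have := h.sonin_pos hφ hU hl
          simp only [soninTwist, hU₁]; simpa using this.le)
      (fun x hx => (h.hasDerivAt_soninTwist hx).continuousAt.continuousWithinAt)
      (fun x hx => (h.hasDerivAt_soninTwist (Ico_subset_Icc_self hx)).hasDerivWithinAt)
      (fun x hx h0 => key x (Ico_subset_Icc_self hx) h0.symm)
    exact this hx
  refine lt_of_le_of_ne (hnn t ht) fun h0 => ?_
  rcases eq_or_lt_of_le ht.1 with rfl | hlt
  · have := h.sonin_pos hφ hU ht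
    simp only [soninTwist, hU₁] at h0
    simp at h0
    linarith
  have hk := key t ht h0.symm
  have hd := (h.hasDerivAt_soninTwist ht).hasDerivWithinAt (s := Iio t)
  rw [hasDerivWithinAt_iff_tendsto_slope' (by simp)] at hd
  have e1 := hd.eventually (lt_mem_nhds hk)
  have e2 : ∀ᶠ y in 𝓝[<] t, y ∈ Ioo l t := Ioo_mem_nhdsLT hlt
  obtain ⟨y, hy1, hy2⟩ := (e1.and e2).exists
  rw [slope_def_field, ← h0, sub_zero] at hy1
  have := hnn y ⟨hy2.1.le, hy2.2.le.trans ht.2⟩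
  have h4 := div_nonpos_of_nonneg_of_nonpos this (by linarith [hy2.2] : y - t ≤ 0)
  linarith

theorem hasDerivAt_phaseCos (h : IsOscillator φ φ₁ φ₂ U U₁ s) (ht : t ∈ s)
    (hf : 0 < sonin φ U U₁ t) :
    HasDerivAt (phaseCos φ U U₁) (-(phaseSpeed φ φ₁ U U₁ t * phaseSin φ U U₁ t)) t := by
  have hp := h.pos t ht
  have hsq : √(sonin φ U U₁ t) ^ 2 = sonin φ U U₁ t := Real.sq_sqrt hf.le
  have hs : 0 < √(sonin φ U U₁ t) := Real.sqrt_pos.2 hf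
  have hs' : 0 < √(φ t) := Real.sqrt_pos.2 hp
  have hdef : sonin φ U U₁ t = U t ^ 2 + U₁ t ^ 2 / φ t := rfl
  refine ((h.hasDerivAt_U t ht).div ((h.hasDerivAt_sonin ht).sqrt hf.ne') hs.ne').congr_deriv ?_
  simp only [phaseSpeed, phaseSin, soninTwist]
  generalize √(sonin φ U U₁ t) = g at *
  rw [hsq, ← sub_eq_zero]
  field_simp
  rw [hsq, hdef]
  field_simp
  ring

theorem hasDerivAt_phaseSin (h : IsOscillator φ φ₁ φ₂ U U₁ s) (ht : t ∈ s)
    (hf : 0 < sonin φ U U₁ t) :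
    HasDerivAt (phaseSin φ U U₁) (phaseSpeed φ φ₁ U U₁ t * phaseCos φ U U₁ t) t := by
  have hp := h.pos t ht
  have hsq : √(sonin φ U U₁ t) ^ 2 = sonin φ U U₁ t := Real.sq_sqrt hf.le
  have hs : 0 < √(sonin φ U U₁ t) := Real.sqrt_pos.2 hf
  have hs' : 0 < √(φ t) := Real.sqrt_pos.2 hp
  have hsq' : √(φ t) ^ 2 = φ t := Real.sq_sqrt hp.le
  have hdef : sonin φ U U₁ t = U t ^ 2 + U₁ t ^ 2 / φ t := rfl
  refine (((h.hasDerivAt_U₁ t ht).neg).div (((h.hasDerivAt_phi t ht).sqrt hp.ne').mul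
    ((h.hasDerivAt_sonin ht).sqrt hf.ne')) (mul_pos hs' hs).ne').congr_deriv ?_
  simp only [phaseSpeed, phaseCos, soninTwist, Pi.mul_apply, Pi.neg_apply]
  generalize √(sonin φ U U₁ t) = g at *
  generalize √(φ t) = p at *
  rw [← sub_eq_zero]
  field_simp
  simp only [hsq, hsq', hdef]
  rw [← hsq']
  field_simp
  ring

theorem phaseSpeed_eq (h : IsOscillator φ φ₁ φ₂ U U₁ s) (ht : t ∈ s)
    (hf : 0 < sonin φ U U₁ t) :
    phaseSpeed φ φ₁ U U₁ t =
      √(φ t) * (1 + slowness φ φ₁ t * (phaseCos φ U U₁ t * phaseSin φ U U₁ t)) := by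
  have hp := h.pos t ht
  have hsq : √(sonin φ U U₁ t) ^ 2 = sonin φ U U₁ t := Real.sq_sqrt hf.le
  have hs : 0 < √(sonin φ U U₁ t) := Real.sqrt_pos.2 hf
  have hs' : 0 < √(φ t) := Real.sqrt_pos.2 hp
  have hsq' : √(φ t) ^ 2 = φ t := Real.sq_sqrt hp.le
  simp only [phaseSpeed, phaseCos, phaseSin, soninTwist, slowness]
  generalize √(sonin φ U U₁ t) = g at *
  generalize √(φ t) = p at *
  rw [← hsq, ← hsq']
  field_simp

theorem hasDerivAt_log_sonin (h : IsOscillator φ φ₁ φ₂ U U₁ s) (ht : t ∈ s)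
    (hf : 0 < sonin φ U U₁ t) :
    HasDerivAt (fun t => Real.log (sonin φ U U₁ t))
      (2 * √(φ t) * slowness φ φ₁ t * phaseSin φ U U₁ t ^ 2) t := by
  have hp := h.pos t ht
  refine ((h.hasDerivAt_sonin ht).log hf.ne').congr_deriv ?_
  have hs' : 0 < √(φ t) := Real.sqrt_pos.2 hp
  simp only [phaseSin, slowness, div_pow, mul_pow, Real.sq_sqrt hf.le, Real.sq_sqrt hp.le]
  field_simp

end IsOscillator

/-- A change of variables with prescribed logarithmic speed. -/
theorem exists_reparametrization {g h : ℝ → ℝ} {l r l' r' : ℝ} (hlr : l ≤ r) (hlr' : l' ≤ r')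
    (hg : ContinuousOn g (Icc l r)) (hg0 : ∀ t ∈ Icc l r, 0 < g t)
    (hh : ContinuousOn h (Icc l' r')) (hh0 : ∀ t ∈ Icc l' r', 0 < h t) :
    ∃ z : ℝ → ℝ, z l = l' ∧ StrictMono z ∧ Continuous z ∧
      ∀ t ∈ Icc l r, z t ∈ Icc l' r' → HasDerivAt z (g t / h (z t)) t := by
  have prim : ∀ {g : ℝ → ℝ} {l r : ℝ} (_ : l ≤ r) (_ : ContinuousOn g (Icc l r))
      (_ : ∀ t ∈ Icc l r, 0 < g t), ∃ G : ℝ → ℝ, G l = 0 ∧ StrictMono G ∧ Continuous G ∧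
      Function.Surjective G ∧ (∀ t, ∃ g', g' ≠ 0 ∧ HasDerivAt G g' t) ∧
      ∀ t ∈ Icc l r, HasDerivAt G (g t) t := by
    intro g l r hlr hg hg0
    set e : ℝ → ℝ := IccExtend hlr ((Icc l r).domRestrict g) with he
    have hec : Continuous e := (continuousOn_iff_continuous_domRestrict.1 hg).Icc_extend'
    obtain ⟨x, hx, hmin⟩ := isCompact_Icc.exists_isMinOn (nonempty_Icc.2 hlr) hg
    have hm : ∀ t, g x ≤ e t := fun t => hmin (projIcc l r hlr t).2
    have hx0 := hg0 x hx
    have hd : ∀ t, HasDerivAt (fun t => ∫ u in l..t, e u) (e t) t := fun t =>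
      intervalIntegral.integral_hasDerivAt_right (hec.intervalIntegrable _ _)
        (hec.stronglyMeasurableAtFilter _ _) hec.continuousAt
    have hc : Continuous (fun t => ∫ u in l..t, e u) :=
      continuous_iff_continuousAt.2 fun t => (hd t).continuousAt
    have hmono : Monotone (fun t => (∫ u in l..t, e u) - g x * t) :=
      monotone_of_hasDerivAt_nonneg
        (fun t => (hd t).sub ((hasDerivAt_id t).const_mul (g x)))
        (fun t => by simpa using hm t)
    refine ⟨fun t => ∫ u in l..t, e u, by simp, ?_, hc, ?_, ?_, ?_⟩
    · exact strictMono_of_hasDerivAt_pos hd fun t => hx0.trans_le (hm t)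
    · refine hc.surjective ?_ ?_
      · refine tendsto_atTop_mono' atTop (f₁ := fun t => g x * t - g x * l) ?_ ?_
        · filter_upwards [eventually_ge_atTop l] with t ht
          have := hmono ht
          simp at this
          linarith
        · exact tendsto_atTop_add_const_right _ _ (tendsto_id.const_mul_atTop hx0)
      · refine tendsto_atBot_mono' atBot (f₁ := fun t => g x * t - g x * l) ?_ ?_
        · filter_upwards [eventually_le_atBot l] with t ht
          have := hmono ht
          simp at this
          linarith
        · exact tendsto_atBot_add_const_right _ _ (tendsto_id.const_mul_atBot hx0)
    · exact fun t => ⟨e t, (hx0.trans_le (hm t)).ne', hd t⟩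
    · intro t ht
      have : e t = g t := by rw [he, IccExtend_of_mem hlr _ ht]; rfl
      exact this ▸ hd t
  obtain ⟨G, hG0, hGm, hGc, -, -, hGd⟩ := prim hlr hg hg0
  obtain ⟨H, hH0, hHm, -, hHs, -, hHd⟩ := prim hlr' hh hh0
  set e := hHm.orderIsoOfSurjective H hHs
  have hHe : ∀ y, H (e.symm y) = y := fun y => e.apply_symm_apply y
  refine ⟨fun t => e.symm (G t), ?_, e.symm.strictMono.comp hGm,
    e.symm.continuous.comp hGc, fun t ht hz => ?_⟩
  · apply hHm.injective
    rw [hHe, hG0, hH0]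
  · have h1 := HasDerivAt.of_local_left_inverse (f := H) (g := e.symm) (a := G t)
      e.symm.continuous.continuousAt (hHd _ hz) (hh0 _ hz).ne'
      (Eventually.of_forall hHe)
    exact (h1.comp t (hGd t ht)).congr_deriv (by ring)

theorem IsOscillator.deriv_slowness_eq {φ φ₁ φ₂ U U₁ : ℝ → ℝ} {s : Set ℝ} {t : ℝ}
    (h : IsOscillator φ φ₁ φ₂ U U₁ s) (ht : t ∈ s) :
    (3 * φ₁ t ^ 2 - 2 * φ t * φ₂ t) / (4 * φ t ^ 2 * √(φ t)) =
      √(φ t) * (3 * slowness φ φ₁ t ^ 2 - φ₂ t / (2 * φ t ^ 2)) := by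
  have hp := h.pos t ht
  have hs' : 0 < √(φ t) := Real.sqrt_pos.2 hp
  have hsq' : √(φ t) ^ 2 = φ t := Real.sq_sqrt hp.le
  simp only [slowness]
  generalize √(φ t) = p at *
  rw [← hsq']
  field_simp
  ring

/-- Comparison of the Sonin functions of two oscillators, matched along equal Prüfer phase. -/
theorem sonin_comparison {φ φ₁ φ₂ U U₁ ψ ψ₁ ψ₂ V V₁ : ℝ → ℝ} {l r l' r' C : ℝ}
    (hu : IsOscillator φ φ₁ φ₂ U U₁ (Icc l r)) (hv : IsOscillator ψ ψ₁ ψ₂ V V₁ (Icc l' r'))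
    (hlr : l ≤ r) (hlr' : l' ≤ r') (hφ₁ : ∀ t ∈ Icc l r, φ₁ t < 0)
    (hψ₁ : ∀ t ∈ Ico l' r', ψ₁ t < 0) (hψr : ψ₁ r' = 0) (hU : 0 < U l) (hU₁ : U₁ l = 0)
    (hV : 0 < V l') (hV₁ : V₁ l' = 0) (hle : slowness φ φ₁ l ≤ slowness ψ ψ₁ l')
    (hcross : ∀ t ∈ Icc l r, ∀ z ∈ Ico l' r', slowness φ φ₁ t = slowness ψ ψ₁ z →
      ψ₂ z / ψ z ^ 2 < φ₂ t / φ t ^ 2)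
    (hC : 0 < C) (hUV : U l ^ 2 ≤ C * V l' ^ 2) :
    sonin φ U U₁ r ≤ C * sonin ψ V V₁ r' := by
  have hφ : ∀ t ∈ Icc l r, φ₁ t ≤ 0 := fun t ht => (hφ₁ t ht).le
  have hψ : ∀ t ∈ Icc l' r', ψ₁ t ≤ 0 := fun t ht => by
    rcases eq_or_lt_of_le ht.2 with rfl | h
    · exact hψr.le
    · exact (hψ₁ t ⟨ht.1, h⟩).le
  have hSu : ∀ t ∈ Icc l r, 0 < sonin φ U U₁ t := fun t ht => hu.sonin_pos hφ hU.ne' ht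
  have hSv : ∀ t ∈ Icc l' r', 0 < sonin ψ V V₁ t := fun t ht => hv.sonin_pos hψ hV.ne' ht
  have hpu : ∀ t ∈ Icc l r, 0 < phaseSpeed φ φ₁ U U₁ t := fun t ht =>
    div_pos (mul_pos (Real.sqrt_pos.2 (hu.pos t ht)) (hu.soninTwist_pos hφ hU.ne' hU₁ ht)) (hSu t ht)
  have hpv : ∀ t ∈ Icc l' r', 0 < phaseSpeed ψ ψ₁ V V₁ t := fun t ht =>
    div_pos (mul_pos (Real.sqrt_pos.2 (hv.pos t ht)) (hv.soninTwist_pos hψ hV.ne' hV₁ ht)) (hSv t ht)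
  obtain ⟨z, hzl, hzm, hzc, hzd⟩ := exists_reparametrization hlr hlr'
    (g := phaseSpeed φ φ₁ U U₁) (h := phaseSpeed ψ ψ₁ V V₁)
    (fun t ht => (((hu.hasDerivAt_phi t ht).continuousAt.sqrt.mul
      (hu.hasDerivAt_soninTwist ht).continuousAt).div (hu.hasDerivAt_sonin ht).continuousAt
        (hSu t ht).ne').continuousWithinAt) hpu
    (fun t ht => (((hv.hasDerivAt_phi t ht).continuousAt.sqrt.mul
      (hv.hasDerivAt_soninTwist ht).continuousAt).div (hv.hasDerivAt_sonin ht).continuousAt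
        (hSv t ht).ne').continuousWithinAt) hpv
  have main : ∀ r₀ ∈ Icc l r, z r₀ ≤ r' → slowness φ φ₁ r₀ ≤ slowness ψ ψ₁ (z r₀) ∧
      Real.log (sonin φ U U₁ r₀) ≤ Real.log C + Real.log (sonin ψ V V₁ (z r₀)) := by
    intro r₀ hr₀ hzr
    have hmem : ∀ t ∈ Icc l r₀, t ∈ Icc l r := fun t ht => ⟨ht.1, ht.2.trans hr₀.2⟩
    have hzmem : ∀ t ∈ Icc l r₀, z t ∈ Icc l' r' := fun t ht =>
      ⟨hzl ▸ hzm.monotone ht.1, (hzm.monotone ht.2).trans hzr⟩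
    have hz' : ∀ t ∈ Icc l r₀, HasDerivAt z _ t := fun t ht => hzd t (hmem t ht) (hzmem t ht)
    have hcu := fun t ht => hu.hasDerivAt_phaseCos (hmem t ht) (hSu t (hmem t ht))
    have hsu := fun t ht => hu.hasDerivAt_phaseSin (hmem t ht) (hSu t (hmem t ht))
    have hcv := fun t ht =>
      (hv.hasDerivAt_phaseCos (hzmem t ht) (hSv _ (hzmem t ht))).comp t (hz' t ht)
    have hsv := fun t ht =>
      (hv.hasDerivAt_phaseSin (hzmem t ht) (hSv _ (hzmem t ht))).comp t (hz' t ht)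
    have hdist : ∀ t ∈ Icc l r₀, HasDerivAt (fun t =>
        (phaseCos φ U U₁ t - phaseCos ψ V V₁ (z t)) ^ 2 +
        (phaseSin φ U U₁ t - phaseSin ψ V V₁ (z t)) ^ 2) 0 t := fun t ht => by
      refine ((((hcu t ht).sub (hcv t ht)).pow 2).add
        (((hsu t ht).sub (hsv t ht)).pow 2)).congr_deriv ?_
      have := (hpv _ (hzmem t ht)).ne'
      simp only [Pi.sub_apply, Function.comp]
      field_simp
      ring
    have heq : ∀ t ∈ Icc l r₀, phaseCos φ U U₁ t = phaseCos ψ V V₁ (z t) ∧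
        phaseSin φ U U₁ t = phaseSin ψ V V₁ (z t) := by
      intro t ht
      have h1 := constant_of_has_deriv_right_zero
        (fun t ht => (hdist t ht).continuousAt.continuousWithinAt)
        (fun t ht => (hdist t (Ico_subset_Icc_self ht)).hasDerivWithinAt) t ht
      have h2 : (phaseCos φ U U₁ l - phaseCos ψ V V₁ (z l)) ^ 2 +
          (phaseSin φ U U₁ l - phaseSin ψ V V₁ (z l)) ^ 2 = 0 := by
        simp [phaseCos, phaseSin, sonin, hzl, hU₁, hV₁, Real.sqrt_sq hU.le, Real.sqrt_sq hV.le,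
          hU.ne', hV.ne']
      simp only [h2] at h1
      constructor <;> nlinarith [sq_nonneg (phaseCos φ U U₁ t - phaseCos ψ V V₁ (z t)),
        sq_nonneg (phaseSin φ U U₁ t - phaseSin ψ V V₁ (z t))]
    have hratio : ∀ t ∈ Icc l r₀, √(ψ (z t)) *
        (1 + slowness ψ ψ₁ (z t) * (phaseCos φ U U₁ t * phaseSin φ U U₁ t)) *
        (phaseSpeed φ φ₁ U U₁ t / phaseSpeed ψ ψ₁ V V₁ (z t)) =
        √(φ t) * (1 + slowness φ φ₁ t * (phaseCos φ U U₁ t * phaseSin φ U U₁ t)) := by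
      intro t ht
      have := (hpv _ (hzmem t ht)).ne'
      rw [(heq t ht).1, (heq t ht).2, ← hv.phaseSpeed_eq (hzmem t ht) (hSv _ (hzmem t ht)),
        ← (heq t ht).1, ← (heq t ht).2, ← hu.phaseSpeed_eq (hmem t ht) (hSu _ (hmem t ht))]
      field_simp
    have hpos_v : ∀ t ∈ Icc l r₀,
        0 < 1 + slowness ψ ψ₁ (z t) * (phaseCos φ U U₁ t * phaseSin φ U U₁ t) := by
      intro t ht
      have := hpv _ (hzmem t ht)
      rw [hv.phaseSpeed_eq (hzmem t ht) (hSv _ (hzmem t ht)), ← (heq t ht).1, ← (heq t ht).2]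
        at this
      exact pos_of_mul_pos_right this (Real.sqrt_nonneg _)
    have hslow : ∀ t ∈ Icc l r₀, slowness φ φ₁ t ≤ slowness ψ ψ₁ (z t) := by
      have hd1 := fun t ht => hu.hasDerivAt_slowness (hmem t ht)
      have hd2 := fun t ht => (hv.hasDerivAt_slowness (hzmem t ht)).comp t (hz' t ht)
      refine image_le_of_deriv_right_lt_deriv_boundary'
        (fun t ht => (hd1 t ht).continuousAt.continuousWithinAt)
        (fun t ht => (hd1 t (Ico_subset_Icc_self ht)).hasDerivWithinAt) (hzl ▸ hle)
        (fun t ht => (hd2 t ht).continuousAt.continuousWithinAt)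
        (fun t ht => (hd2 t (Ico_subset_Icc_self ht)).hasDerivWithinAt) ?_
      intro t ht' hEq
      have ht := Ico_subset_Icc_self ht'
      have hlt : z t < r' := (hzm ht'.2).trans_le hzr
      have hc := hcross t (hmem t ht) (z t) ⟨(hzmem t ht).1, hlt⟩ hEq
      have hr := hratio t ht
      have hp := hpos_v t ht
      rw [hu.deriv_slowness_eq (hmem t ht), hv.deriv_slowness_eq (hzmem t ht)]
      rw [hEq] at hr ⊢
      have hr' : √(ψ (z t)) * (phaseSpeed φ φ₁ U U₁ t / phaseSpeed ψ ψ₁ V V₁ (z t)) = √(φ t) := by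
        apply mul_right_cancel₀ hp.ne'
        linarith
      have hpφ : 0 < √(φ t) := Real.sqrt_pos.2 (hu.pos t (hmem t ht))
      calc _ < √(φ t) * (3 * slowness ψ ψ₁ (z t) ^ 2 - ψ₂ (z t) / (2 * ψ (z t) ^ 2)) := by
            refine mul_lt_mul_of_pos_left ?_ hpφ
            rw [div_mul_eq_div_div_swap, div_mul_eq_div_div_swap]
            linarith
        _ = _ := by rw [← hr']; ring
    refine ⟨hslow r₀ ⟨hr₀.1, le_rfl⟩, ?_⟩
    have hd1 := fun t ht => hu.hasDerivAt_log_sonin (hmem t ht) (hSu t (hmem t ht))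
    have hd2 := fun t ht => ((hv.hasDerivAt_log_sonin (hzmem t ht) (hSv _ (hzmem t ht))).comp t
      (hz' t ht)).const_add (Real.log C)
    refine image_le_of_deriv_right_le_deriv_boundary
        (fun t ht => (hd1 t ht).continuousAt.continuousWithinAt)
        (fun t ht => (hd1 t (Ico_subset_Icc_self ht)).hasDerivWithinAt) ?_
        (fun t ht => (hd2 t ht).continuousAt.continuousWithinAt)
        (fun t ht => (hd2 t (Ico_subset_Icc_self ht)).hasDerivWithinAt) ?_ (⟨hr₀.1, le_rfl⟩ :
          r₀ ∈ Icc l r₀)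
    · have hVl : 0 < V l' ^ 2 := by positivity
      simp only [Function.comp, hzl, sonin, hU₁, hV₁]
      norm_num only [zero_div, add_zero, zero_pow]
      rw [← Real.log_mul hC.ne' hVl.ne']
      exact Real.log_le_log (by positivity) hUV
    · intro t ht'
      have ht := Ico_subset_Icc_self ht'
      have hr := hratio t ht
      have hp := hpos_v t ht
      have hs := hslow t ht
      rw [← (heq t ht).2]
      have hpφ : 0 ≤ √(φ t) := Real.sqrt_nonneg _
      have hr' : √(ψ (z t)) * (phaseSpeed φ φ₁ U U₁ t / phaseSpeed ψ ψ₁ V V₁ (z t)) =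
          √(φ t) * ((1 + slowness φ φ₁ t * (phaseCos φ U U₁ t * phaseSin φ U U₁ t)) /
          (1 + slowness ψ ψ₁ (z t) * (phaseCos φ U U₁ t * phaseSin φ U U₁ t))) := by
        rw [← mul_div_assoc (√(φ t)), eq_div_iff hp.ne']
        linarith
      have h3 : slowness φ φ₁ t ≤ slowness ψ ψ₁ (z t) *
          ((1 + slowness φ φ₁ t * (phaseCos φ U U₁ t * phaseSin φ U U₁ t)) /
          (1 + slowness ψ ψ₁ (z t) * (phaseCos φ U U₁ t * phaseSin φ U U₁ t))) := by
        rw [← mul_div_assoc (slowness ψ ψ₁ (z t)), le_div_iff₀ hp]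
        linarith
      calc _ = 2 * (√(φ t) * phaseSin φ U U₁ t ^ 2) * slowness φ φ₁ t := by ring
        _ ≤ 2 * (√(φ t) * phaseSin φ U U₁ t ^ 2) * _ :=
          mul_le_mul_of_nonneg_left h3 (by positivity)
        _ = 2 * slowness ψ ψ₁ (z t) * phaseSin φ U U₁ t ^ 2 *
          (√(ψ (z t)) * (phaseSpeed φ φ₁ U U₁ t / phaseSpeed ψ ψ₁ V V₁ (z t))) := by
            rw [hr']; ring
        _ = _ := by ring
  have hzr : z r ≤ r' := by
    by_contra! hcon
    obtain ⟨r₀, hr₀, hzr₀⟩ := intermediate_value_Icc hlr hzc.continuousOn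
      (⟨hzl ▸ hlr', hcon.le⟩ : r' ∈ Icc (z l) (z r))
    have h1 := (main r₀ hr₀ hzr₀.le).1
    rw [hzr₀] at h1
    have h2 : 0 < slowness φ φ₁ r₀ := by
      have := hu.pos r₀ hr₀
      have h3 := hφ₁ r₀ hr₀
      have := Real.sqrt_pos.2 this
      exact div_pos (by linarith) (by positivity)
    simp [slowness, hψr] at h1 h2
    linarith
  have hr := right_mem_Icc.2 hlr
  have hzm' : z r ∈ Icc l' r' := ⟨hzl ▸ hzm.monotone hlr, hzr⟩
  have h1 := (main r hr hzr).2
  rw [← Real.log_mul hC.ne' (hSv _ hzm').ne'] at h1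
  have h2 := (Real.log_le_log_iff (hSu r hr) (mul_pos hC (hSv _ hzm'))).1 h1
  exact h2.trans (mul_le_mul_of_nonneg_left
    (hv.sonin_monotoneOn hψ hzm' (right_mem_Icc.2 hlr') hzr) hC.le)

/-- The coefficients of the Jacobi polynomial with value `1` at `0` orthogonal with respect to
`x ^ (a - 1/2) * (1 - x) ^ (b - 1/2)` on `[0, 1]`. -/
noncomputable def jacobiCoeff (a b : ℝ) (n : ℕ) : ℕ → ℝ
  | 0 => 1
  | k + 1 => (k - n) * (k + n + a + b) / ((k + 1) * (k + a + 1 / 2)) * jacobiCoeff a b n k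

/-- The Jacobi polynomial with value `1` at `0` orthogonal with respect to
`x ^ (a - 1/2) * (1 - x) ^ (b - 1/2)` on `[0, 1]`. -/
noncomputable def jacobiPoly (a b : ℝ) (n : ℕ) : Polynomial ℝ :=
  ∑ k ∈ Finset.range (n + 1), Polynomial.monomial k (jacobiCoeff a b n k)

theorem jacobiCoeff_eq_zero (a b : ℝ) (n : ℕ) (j : ℕ) : jacobiCoeff a b n (n + 1 + j) = 0 := by
  induction j with
  | zero => simp [jacobiCoeff]
  | succ j ih => rw [← add_assoc, jacobiCoeff, ih, mul_zero]

theorem jacobiCoeff_succ {a : ℝ} (ha : 0 ≤ a) (b : ℝ) (n k : ℕ) :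
    (k + 1) * (k + a + 1 / 2) * jacobiCoeff a b n (k + 1) =
      (k - n) * (k + n + a + b) * jacobiCoeff a b n k := by
  have : (k : ℝ) + a + 1 / 2 ≠ 0 := by positivity
  rw [jacobiCoeff]
  field_simp

theorem coeff_jacobiPoly (a b : ℝ) (n k : ℕ) :
    (jacobiPoly a b n).coeff k = jacobiCoeff a b n k := by
  simp only [jacobiPoly, Polynomial.finsetSum_coeff, Polynomial.coeff_monomial]
  rw [Finset.sum_ite_eq']
  split_ifs with h
  · rfl
  · obtain ⟨j, rfl⟩ := Nat.exists_eq_add_of_le (by simpa using h : n + 1 ≤ k)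
    rw [jacobiCoeff_eq_zero]

theorem jacobiPoly_eval_zero (a b : ℝ) (n : ℕ) : (jacobiPoly a b n).eval 0 = 1 := by
  rw [← Polynomial.coeff_zero_eq_eval_zero, coeff_jacobiPoly, jacobiCoeff]

open Polynomial in
theorem jacobiPoly_ode {a : ℝ} (ha : 0 ≤ a) (b : ℝ) (n : ℕ) :
    X * derivative (derivative (jacobiPoly a b n)) -
      X * (X * derivative (derivative (jacobiPoly a b n))) +
      C (a + 1 / 2) * derivative (jacobiPoly a b n) -
      C (a + b + 1) * (X * derivative (jacobiPoly a b n)) +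
      C (n * (n + a + b)) * jacobiPoly a b n = 0 := by
  ext k
  have h := jacobiCoeff_succ ha b n k
  simp only [coeff_add, coeff_sub, coeff_C_mul, coeff_zero]
  rcases k with _ | _ | k
  · simp only [coeff_X_mul_zero, coeff_derivative, coeff_jacobiPoly] at h ⊢
    push_cast at h ⊢
    linear_combination h
  · simp only [coeff_X_mul, coeff_X_mul_zero, coeff_derivative, coeff_jacobiPoly] at h ⊢
    push_cast at h ⊢
    linear_combination h
  · simp only [coeff_X_mul, coeff_derivative, coeff_jacobiPoly] at h ⊢
    push_cast at h ⊢
    linear_combination h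

theorem jacobiPoly_ode_eval {a : ℝ} (ha : 0 ≤ a) (b : ℝ) (n : ℕ) (x : ℝ) :
    x * (1 - x) * (jacobiPoly a b n).derivative.derivative.eval x +
      ((a + 1 / 2) - (a + b + 1) * x) * (jacobiPoly a b n).derivative.eval x +
      n * (n + a + b) * (jacobiPoly a b n).eval x = 0 := by
  have := congrArg (Polynomial.eval x) (jacobiPoly_ode ha b n)
  simp only [Polynomial.eval_add, Polynomial.eval_sub, Polynomial.eval_mul, Polynomial.eval_X,
    Polynomial.eval_C, Polynomial.eval_zero] at this
  linear_combination this

/-- The potential of the Liouville normal form of the Jacobi equation. -/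
noncomputable def jacobiPhi (M A B t : ℝ) : ℝ := M ^ 2 + A / Real.sin t ^ 2 + B / Real.cos t ^ 2

/-- The derivative of `jacobiPhi`. -/
noncomputable def jacobiPhi₁ (A B t : ℝ) : ℝ :=
  -(2 * A * Real.cos t / Real.sin t ^ 3) + 2 * B * Real.sin t / Real.cos t ^ 3

/-- The second derivative of `jacobiPhi`. -/
noncomputable def jacobiPhi₂ (A B t : ℝ) : ℝ :=
  2 * A * (1 + 2 * Real.cos t ^ 2) / Real.sin t ^ 4 +
    2 * B * (1 + 2 * Real.sin t ^ 2) / Real.cos t ^ 4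

/-- The solution of the Liouville normal form of the Jacobi equation. -/
noncomputable def jacobiU (a b : ℝ) (n : ℕ) (t : ℝ) : ℝ :=
  Real.sin t ^ a * Real.cos t ^ b * (jacobiPoly a b n).eval (Real.sin t ^ 2)

/-- The logarithmic derivative of `sin ^ a * cos ^ b`. -/
noncomputable def weightLogDeriv (a b t : ℝ) : ℝ :=
  a * Real.cos t / Real.sin t - b * Real.sin t / Real.cos t

/-- The derivative of `jacobiU`. -/
noncomputable def jacobiU₁ (a b : ℝ) (n : ℕ) (t : ℝ) : ℝ :=
  Real.sin t ^ a * Real.cos t ^ b *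
    (weightLogDeriv a b t * (jacobiPoly a b n).eval (Real.sin t ^ 2) +
      2 * Real.sin t * Real.cos t * (jacobiPoly a b n).derivative.eval (Real.sin t ^ 2))

section
variable {A B a b t : ℝ}

theorem hasDerivAt_jacobiPhi (M : ℝ) (hs : 0 < Real.sin t) (hc : 0 < Real.cos t ∨ B = 0) :
    HasDerivAt (jacobiPhi M A B) (jacobiPhi₁ A B t) t := by
  have h1 : HasDerivAt (fun t => M ^ 2 + A / Real.sin t ^ 2)
      (-(2 * A * Real.cos t / Real.sin t ^ 3)) t := by
    refine (((hasDerivAt_const t A).div ((Real.hasDerivAt_sin t).pow 2)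
      (by simpa using hs.ne')).const_add _).congr_deriv ?_
    simp only [Pi.pow_apply]
    field_simp
    ring
  refine h1.add ?_
  rcases hc with hc | rfl
  · refine ((hasDerivAt_const t B).div ((Real.hasDerivAt_cos t).pow 2)
      (by simpa using hc.ne')).congr_deriv ?_
    simp only [Pi.pow_apply]
    field_simp
    ring
  · simpa using hasDerivAt_const t (0 : ℝ)

theorem hasDerivAt_jacobiPhi₁ (hs : 0 < Real.sin t) (hc : 0 < Real.cos t ∨ B = 0) :
    HasDerivAt (jacobiPhi₁ A B) (jacobiPhi₂ A B t) t := by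
  have hsc := Real.sin_sq_add_cos_sq t
  have h1 : HasDerivAt (fun t => -(2 * A * Real.cos t / Real.sin t ^ 3))
      (2 * A * (1 + 2 * Real.cos t ^ 2) / Real.sin t ^ 4) t := by
    refine (((Real.hasDerivAt_cos t).const_mul (2 * A)).div ((Real.hasDerivAt_sin t).pow 3)
      (by simpa using hs.ne')).neg.congr_deriv ?_
    simp only [Pi.pow_apply]
    field_simp
    push_cast
    ring_nf
    linear_combination A * Real.sin t ^ 2 * hsc
  refine h1.add ?_
  rcases hc with hc | rfl
  · refine (((Real.hasDerivAt_sin t).const_mul (2 * B)).div ((Real.hasDerivAt_cos t).pow 3)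
      (by simpa using hc.ne')).congr_deriv ?_
    simp only [Pi.pow_apply]
    field_simp
    push_cast
    ring_nf
    linear_combination B * Real.cos t ^ 2 * hsc
  · simpa using hasDerivAt_const t (0 : ℝ)

theorem hasDerivAt_jacobiWeight (hs : 0 < Real.sin t) (hc : 0 < Real.cos t ∨ b = 0) :
    HasDerivAt (fun t => Real.sin t ^ a * Real.cos t ^ b)
      (Real.sin t ^ a * Real.cos t ^ b * weightLogDeriv a b t) t := by
  have h1 : HasDerivAt (fun t => Real.sin t ^ a)
      (Real.sin t ^ a * (a * Real.cos t / Real.sin t)) t := by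
    refine ((Real.hasDerivAt_sin t).rpow_const (p := a) (Or.inl hs.ne')).congr_deriv ?_
    rw [Real.rpow_sub_one hs.ne']
    field_simp
  rcases hc with hc | rfl
  · have h2 : HasDerivAt (fun t => Real.cos t ^ b)
        (-(Real.cos t ^ b * (b * Real.sin t / Real.cos t))) t := by
      refine ((Real.hasDerivAt_cos t).rpow_const (p := b) (Or.inl hc.ne')).congr_deriv ?_
      rw [Real.rpow_sub_one hc.ne']
      field_simp
    refine (h1.mul h2).congr_deriv ?_
    unfold weightLogDeriv
    ring
  · simpa [weightLogDeriv] using h1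

theorem hasDerivAt_eval_sin_sq (P : Polynomial ℝ) (t : ℝ) :
    HasDerivAt (fun t => P.eval (Real.sin t ^ 2))
      (2 * Real.sin t * Real.cos t * P.derivative.eval (Real.sin t ^ 2)) t := by
  refine ((P.hasDerivAt _).comp t ((Real.hasDerivAt_sin t).pow 2)).congr_deriv ?_
  simp only [Pi.pow_apply]
  push_cast
  ring

theorem hasDerivAt_jacobiU (n : ℕ) (hs : 0 < Real.sin t) (hc : 0 < Real.cos t ∨ b = 0) :
    HasDerivAt (jacobiU a b n) (jacobiU₁ a b n t) t := by
  refine ((hasDerivAt_jacobiWeight hs hc).mul (hasDerivAt_eval_sin_sq _ t)).congr_deriv ?_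
  unfold jacobiU₁
  ring

theorem hasDerivAt_weightLogDeriv (hs : 0 < Real.sin t) (hc : 0 < Real.cos t ∨ b = 0) :
    HasDerivAt (weightLogDeriv a b) (-(a / Real.sin t ^ 2) - b / Real.cos t ^ 2) t := by
  have hsc := Real.sin_sq_add_cos_sq t
  have h1 : HasDerivAt (fun t => a * Real.cos t / Real.sin t) (-(a / Real.sin t ^ 2)) t := by
    refine (((Real.hasDerivAt_cos t).const_mul a).div (Real.hasDerivAt_sin t) hs.ne').congr_deriv ?_
    field_simp
    linear_combination -a * hsc
  refine h1.sub ?_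
  rcases hc with hc | rfl
  · refine (((Real.hasDerivAt_sin t).const_mul b).div (Real.hasDerivAt_cos t) hc.ne').congr_deriv ?_
    field_simp
    linear_combination b * hsc
  · simpa using hasDerivAt_const t (0 : ℝ)

theorem hasDerivAt_jacobiU₁ (n : ℕ) (ha : 0 ≤ a) (hs : 0 < Real.sin t)
    (hc : 0 < Real.cos t ∨ b = 0) :
    HasDerivAt (jacobiU₁ a b n)
      (-(jacobiPhi (2 * n + a + b) (a * (1 - a)) (b * (1 - b)) t * jacobiU a b n t)) t := by
  have hode := jacobiPoly_ode_eval ha b n (Real.sin t ^ 2)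
  have hc2 := Real.cos_sq' t
  refine ((hasDerivAt_jacobiWeight hs hc).mul (((hasDerivAt_weightLogDeriv hs hc).mul
    (hasDerivAt_eval_sin_sq (jacobiPoly a b n) t)).add
    ((((Real.hasDerivAt_sin t).const_mul 2).mul (Real.hasDerivAt_cos t)).mul
      (hasDerivAt_eval_sin_sq (jacobiPoly a b n).derivative t)))).congr_deriv ?_
  simp only [Pi.mul_apply, Pi.add_apply, jacobiU, jacobiPhi, weightLogDeriv]
  generalize Real.sin t ^ a * Real.cos t ^ b = w at *
  generalize (jacobiPoly a b n).eval (Real.sin t ^ 2) = R at *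
  generalize (jacobiPoly a b n).derivative.eval (Real.sin t ^ 2) = R' at *
  generalize (jacobiPoly a b n).derivative.derivative.eval (Real.sin t ^ 2) = R'' at *
  generalize Real.sin t = s at *
  generalize Real.cos t = c at *
  rcases hc with hc | rfl
  · have key : s ^ 2 + c ^ 2 = 1 := by linarith
    have e1 : a * c / s - b * s / c = (a * c ^ 2 - b * s ^ 2) / (s * c) := by field_simp
    rw [e1]
    rw [← sub_eq_zero]
    field_simp
    rw [← hc2] at hode
    obtain ⟨x, hx⟩ : ∃ x, x = s ^ 2 := ⟨_, rfl⟩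
    have hcx : c ^ 2 = 1 - x := by rw [hx]; linarith
    have hc4 : c ^ 4 = (1 - x) ^ 2 := by rw [← hcx]; ring
    have hs4 : s ^ 4 = x ^ 2 := by rw [hx]; ring
    rw [hcx, ← hx] at hode
    ring_nf
    simp only [hcx, hc4, hs4, ← hx]
    linear_combination 4 * w * x * (1 - x) * hode
  · rw [← sub_eq_zero]
    simp only [zero_mul, zero_div, sub_zero, add_zero] at hode ⊢
    field_simp
    obtain ⟨x, hx⟩ : ∃ x, x = s ^ 2 := ⟨_, rfl⟩
    have hcx : c ^ 2 = 1 - x := by rw [hx]; linarith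
    have hs4 : s ^ 4 = x ^ 2 := by rw [hx]; ring
    rw [← hx] at hode
    ring_nf
    simp only [hcx, hs4, ← hx]
    linear_combination 4 * w * x * hode

end

theorem le_of_tendsto_of_deriv_nonneg {F F' : ℝ → ℝ} {T L : ℝ} (hT : 0 < T)
    (h : Tendsto F (𝓝[>] 0) (𝓝 L)) (hd : ∀ t ∈ Ioc 0 T, HasDerivAt F (F' t) t)
    (h0 : ∀ t ∈ Ioc 0 T, 0 ≤ F' t) : L ≤ F T := by
  refine le_of_tendsto h ?_
  filter_upwards [Ioo_mem_nhdsGT hT] with t ht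
  have := monotoneOn_of_hasDerivWithinAt_nonneg (convex_Ioc 0 T)
    (fun t ht => (hd t ht).continuousAt.continuousWithinAt)
    (fun t ht => (hd t (interior_subset ht)).hasDerivWithinAt)
    (fun t ht => h0 t (interior_subset ht))
  exact this ⟨ht.1, ht.2.le⟩ ⟨hT, le_rfl⟩ ht.2.le

theorem exists_first_zero {f : ℝ → ℝ} {τ : ℝ} (hτ : 0 < τ) (hf : ContinuousOn f (Ioc 0 τ))
    (h0 : ∀ᶠ t in 𝓝[>] 0, 0 < f t) (hfτ : f τ ≤ 0) :
    ∃ t₁ ∈ Ioc 0 τ, f t₁ = 0 ∧ ∀ t ∈ Ioo 0 t₁, 0 < f t := by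
  obtain ⟨ε, hε, hεf⟩ := mem_nhdsGT_iff_exists_Ioc_subset.1 h0
  have hε' : (0 : ℝ) < ε := hε
  have hετ : ε < τ := by
    by_contra! hcon
    exact absurd (hεf ⟨hτ, hcon⟩) (not_lt.2 hfτ)
  have hfc : ContinuousOn f (Icc ε τ) := hf.mono fun t ht => ⟨hε'.trans_le ht.1, ht.2⟩
  have hcl : IsCompact (Icc ε τ ∩ f ⁻¹' Iic 0) :=
    isCompact_Icc.of_isClosed_subset (hfc.preimage_isClosed_of_isClosed isClosed_Icc isClosed_Iic)
      inter_subset_left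
  obtain ⟨t₁, ht₁, hmin⟩ := hcl.exists_isLeast ⟨τ, ⟨hετ.le, le_rfl⟩, hfτ⟩
  have hpos : ∀ t ∈ Ioo 0 t₁, 0 < f t := by
    intro t ht
    by_contra! hcon
    rcases le_or_gt t ε with h | h
    · exact absurd (hεf ⟨ht.1, h⟩) (not_lt.2 hcon)
    · exact absurd (hmin ⟨⟨h.le, ht.2.le.trans ht₁.1.2⟩, hcon⟩) (not_le.2 ht.2)
  have ht₁0 : 0 < t₁ := hε'.trans_le ht₁.1.1
  refine ⟨t₁, ⟨ht₁0, ht₁.1.2⟩, le_antisymm ht₁.2 ?_, hpos⟩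
  have hc : ContinuousWithinAt f (Ioo 0 t₁) t₁ :=
    (hf t₁ ⟨ht₁0, ht₁.1.2⟩).mono fun t ht => ⟨ht.1, ht.2.le.trans ht₁.1.2⟩
  have : (𝓝[Ioo 0 t₁] t₁).NeBot := mem_closure_iff_nhdsWithin_neBot.1 (by
    rw [closure_Ioo ht₁0.ne]; exact ⟨ht₁0.le, le_rfl⟩)
  refine ge_of_tendsto hc.tendsto ?_
  filter_upwards [self_mem_nhdsWithin] with t ht using (hpos t ht).le

theorem eventually_nhdsGT_zero_mem_Ioo {T : ℝ} (hT : 0 < T) : ∀ᶠ t in 𝓝[>] (0 : ℝ), t ∈ Ioo 0 T :=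
  Ioo_mem_nhdsGT hT

theorem Continuous.tendsto_nhdsGT_zero {f : ℝ → ℝ} {c : ℝ} (hf : Continuous f) (h : f 0 = c) :
    Tendsto f (𝓝[>] 0) (𝓝 c) := h ▸ (hf.tendsto 0).mono_left nhdsWithin_le_nhds

section
variable {a b : ℝ}

theorem sin_pos_of_mem_Ioo {t : ℝ} (ht : t ∈ Ioo 0 (Real.pi / 2)) : 0 < Real.sin t :=
  Real.sin_pos_of_pos_of_lt_pi ht.1 (by linarith [ht.2, Real.pi_pos])

theorem cos_pos_of_mem_Ioo {t : ℝ} (ht : t ∈ Ioo 0 (Real.pi / 2)) : 0 < Real.cos t :=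
  Real.cos_pos_of_mem_Ioo ⟨by linarith [ht.1, Real.pi_pos], ht.2⟩

theorem eventually_jacobiU_pos (n : ℕ) : ∀ᶠ t in 𝓝[>] 0, 0 < jacobiU a b n t := by
  have h1 : Tendsto (fun t => (jacobiPoly a b n).eval (Real.sin t ^ 2)) (𝓝[>] 0) (𝓝 1) := by
    exact Continuous.tendsto_nhdsGT_zero (by fun_prop) (by simp [jacobiPoly_eval_zero])
  filter_upwards [h1.eventually (lt_mem_nhds one_pos),
    eventually_nhdsGT_zero_mem_Ioo (half_pos Real.pi_pos)] with t h2 h3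
  have := sin_pos_of_mem_Ioo h3
  have := cos_pos_of_mem_Ioo h3
  unfold jacobiU
  positivity

theorem eventually_jacobiU₁_pos (ha : 0 < a) (n : ℕ) : ∀ᶠ t in 𝓝[>] 0, 0 < jacobiU₁ a b n t := by
  have h1 : Tendsto (fun t => (a * Real.cos t - b * Real.sin t ^ 2 / Real.cos t) *
      (jacobiPoly a b n).eval (Real.sin t ^ 2) + 2 * Real.sin t ^ 2 * Real.cos t *
      (jacobiPoly a b n).derivative.eval (Real.sin t ^ 2)) (𝓝[>] 0) (𝓝 a) := by
    have h2 : Tendsto (fun t : ℝ => b * Real.sin t ^ 2 / Real.cos t) (𝓝[>] 0) (𝓝 0) := by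
      have := (Continuous.tendsto_nhdsGT_zero (f := fun t => b * Real.sin t ^ 2) (c := 0)
        (by fun_prop) (by simp)).div (Continuous.tendsto_nhdsGT_zero (f := Real.cos) (c := 1)
        (by fun_prop) (by simp)) one_ne_zero
      rw [zero_div] at this
      exact this
    have := (((Continuous.tendsto_nhdsGT_zero (f := fun t => a * Real.cos t) (c := a)
        (by fun_prop) (by simp)).sub h2).mul (Continuous.tendsto_nhdsGT_zero (c := 1)
      (f := fun t => (jacobiPoly a b n).eval (Real.sin t ^ 2)) (by fun_prop)
        (by simp [jacobiPoly_eval_zero]))).add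
      (Continuous.tendsto_nhdsGT_zero (f := fun t => 2 * Real.sin t ^ 2 * Real.cos t *
      (jacobiPoly a b n).derivative.eval (Real.sin t ^ 2)) (c := 0) (by fun_prop) (by simp))
    simpa using this
  filter_upwards [h1.eventually (lt_mem_nhds ha),
    eventually_nhdsGT_zero_mem_Ioo (half_pos Real.pi_pos)] with t h2 h3
  have hs := sin_pos_of_mem_Ioo h3
  have hc := cos_pos_of_mem_Ioo h3
  have : jacobiU₁ a b n t = Real.sin t ^ a * Real.cos t ^ b * (((a * Real.cos t -
      b * Real.sin t ^ 2 / Real.cos t) * (jacobiPoly a b n).eval (Real.sin t ^ 2) +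
      2 * Real.sin t ^ 2 * Real.cos t *
      (jacobiPoly a b n).derivative.eval (Real.sin t ^ 2)) / Real.sin t) := by
    unfold jacobiU₁ weightLogDeriv
    field_simp
  rw [this]
  positivity

theorem cot_mem_Icc {t : ℝ} (ht : t ∈ Ioo 0 (Real.pi / 2)) :
    1 / t - t / 2 ≤ Real.cos t / Real.sin t ∧ Real.cos t / Real.sin t ≤ 1 / t := by
  have hs := sin_pos_of_mem_Ioo ht
  have hc := cos_pos_of_mem_Ioo ht
  have h0 := ht.1
  constructor
  · have h1 := Real.one_sub_sq_div_two_le_cos (x := t)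
    have h2 := Real.sin_lt ht.1
    rw [le_div_iff₀ hs]
    have h3 : (1 / t - t / 2) = (1 - t ^ 2 / 2) / t := by field_simp
    rw [h3, div_mul_eq_mul_div, div_le_iff₀ h0]
    rcases le_or_gt 0 (1 - t ^ 2 / 2) with h | h <;> nlinarith
  · have h1 := Real.lt_tan ht.1 ht.2
    rw [Real.tan_eq_sin_div_cos, lt_div_iff₀ hc] at h1
    rw [div_le_div_iff₀ hs h0]
    linarith

theorem tendsto_cot_sub_mul_cot {μ : ℝ} (hμ : 0 < μ) (hμ1 : μ ≤ 1) :
    Tendsto (fun t => Real.cos t / Real.sin t - μ * (Real.cos (μ * t) / Real.sin (μ * t)))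
      (𝓝[>] 0) (𝓝 0) := by
  refine tendsto_of_tendsto_of_tendsto_of_le_of_le' (g := fun t => -(t / 2))
    (h := fun t => μ ^ 2 * t / 2) ?_ ?_ ?_ ?_
  · exact Continuous.tendsto_nhdsGT_zero (by fun_prop) (by simp)
  · exact Continuous.tendsto_nhdsGT_zero (by fun_prop) (by simp)
  all_goals
    filter_upwards [eventually_nhdsGT_zero_mem_Ioo (half_pos Real.pi_pos)] with t ht
    have h0 := ht.1
    have h1 := cot_mem_Icc ht
    have h2 := cot_mem_Icc (t := μ * t) ⟨by positivity, by nlinarith [ht.1, ht.2]⟩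
    have h3 := mul_le_mul_of_nonneg_left h2.1 hμ.le
    have h4 := mul_le_mul_of_nonneg_left h2.2 hμ.le
    have h5 : μ * (1 / (μ * t)) = 1 / t := by field_simp
    rw [mul_sub] at h3
    rw [h5] at h3 h4
  · linarith
  · linarith

theorem tendsto_jacobi_wronskian (ha : 0 < a) (n k : ℕ) {μ : ℝ} (hμ : 0 < μ) (hμ1 : μ ≤ 1) :
    Tendsto (fun t => jacobiU₁ a b n t * jacobiU a 0 k (μ * t) -
      jacobiU a b n t * (μ * jacobiU₁ a 0 k (μ * t))) (𝓝[>] 0) (𝓝 0) := by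
  have hR : ∀ (P : Polynomial ℝ) (ν : ℝ),
      Tendsto (fun t => P.eval (Real.sin (ν * t) ^ 2)) (𝓝[>] 0) (𝓝 (P.eval 0)) := by
    intro P ν
    exact Continuous.tendsto_nhdsGT_zero (by fun_prop) (by simp)
  have hs : ∀ ν : ℝ, Tendsto (fun t => Real.sin (ν * t)) (𝓝[>] 0) (𝓝 0) := fun ν =>
    Continuous.tendsto_nhdsGT_zero (by fun_prop) (by simp)
  have hc : ∀ ν : ℝ, Tendsto (fun t => Real.cos (ν * t)) (𝓝[>] 0) (𝓝 1) := fun ν =>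
    Continuous.tendsto_nhdsGT_zero (by fun_prop) (by simp)
  have hsa : ∀ ν : ℝ, Tendsto (fun t => Real.sin (ν * t) ^ a) (𝓝[>] 0) (𝓝 0) := fun ν => by
    simpa [Real.zero_rpow ha.ne'] using (hs ν).rpow_const (p := a) (Or.inr ha.le)
  have hcb : Tendsto (fun t => Real.cos (1 * t) ^ b) (𝓝[>] 0) (𝓝 1) := by
    simpa using (hc 1).rpow_const (p := b) (Or.inl one_ne_zero)
  have htan : Tendsto (fun t => b * (Real.sin (1 * t) / Real.cos (1 * t))) (𝓝[>] 0) (𝓝 0) := by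
    simpa using ((hs 1).div (hc 1) one_ne_zero).const_mul b
  have hcot := (tendsto_cot_sub_mul_cot hμ hμ1).const_mul a
  have h1 := (((hsa 1).mul (hsa μ)).mul hcb).mul
    (((((hR (jacobiPoly a b n) 1).mul (hR (jacobiPoly a 0 k) μ)).mul (hcot.sub htan)).add
    (((((hs 1).const_mul 2).mul (hc 1)).mul (hR (jacobiPoly a b n).derivative 1)).mul
      (hR (jacobiPoly a 0 k) μ))).sub
    (((((hs μ).const_mul 2).mul (hc μ)).mul (hR (jacobiPoly a 0 k).derivative μ)).mul
      ((hR (jacobiPoly a b n) 1).mul_const μ)))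
  simp only [mul_zero, zero_mul] at h1
  refine h1.congr fun t => ?_
  simp only [one_mul, jacobiU, jacobiU₁, weightLogDeriv, Real.rpow_zero]
  ring

theorem tendsto_jacobi_ratio (n k : ℕ) {μ : ℝ} (hμ : 0 < μ) :
    Tendsto (fun t => jacobiU a b n t / jacobiU a 0 k (μ * t)) (𝓝[>] 0) (𝓝 (μ⁻¹ ^ a)) := by
  have hR : ∀ (P : Polynomial ℝ) (ν : ℝ),
      Tendsto (fun t => P.eval (Real.sin (ν * t) ^ 2)) (𝓝[>] 0) (𝓝 (P.eval 0)) := by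
    intro P ν
    exact Continuous.tendsto_nhdsGT_zero (by fun_prop) (by simp)
  have hs : ∀ ν : ℝ, Tendsto (fun t => t⁻¹ * Real.sin (ν * t)) (𝓝[>] 0) (𝓝 ν) := fun ν => by
    have h : HasDerivAt (fun t => Real.sin (ν * t)) ν 0 := by
      simpa using ((hasDerivAt_id (0 : ℝ)).const_mul ν).sin
    have h' := hasDerivAt_iff_tendsto_slope_zero.1 h
    have := h'.mono_left (nhdsWithin_mono 0 (show Ioi (0 : ℝ) ⊆ {0}ᶜ from fun t ht => ht.ne'))
    simpa using this
  have hcb : Tendsto (fun t => Real.cos (1 * t) ^ b) (𝓝[>] 0) (𝓝 1) := by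
    have := Continuous.tendsto_nhdsGT_zero (f := fun t => Real.cos (1 * t)) (c := 1)
      (by fun_prop) (by simp)
    simpa using this.rpow_const (p := b) (Or.inl one_ne_zero)
  have h1 := (((((hs 1).div (hs μ) hμ.ne').rpow_const (p := a)
    (Or.inl (by simpa using hμ.ne'))).mul hcb).mul (hR (jacobiPoly a b n) 1)).div
    (hR (jacobiPoly a 0 k) μ) (by simp [jacobiPoly_eval_zero])
  simp only [jacobiPoly_eval_zero, mul_one, div_one, one_div] at h1
  refine h1.congr' ?_
  filter_upwards [eventually_nhdsGT_zero_mem_Ioo (half_pos Real.pi_pos),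
    eventually_nhdsGT_zero_mem_Ioo (div_pos Real.pi_pos hμ)] with t ht ht2
  have ht0 := ht.1
  have h3 : 0 < Real.sin (μ * t) := Real.sin_pos_of_pos_of_lt_pi (by positivity) (by
    have := ht2.2; rw [lt_div_iff₀ hμ] at this; linarith)
  have h4 := sin_pos_of_mem_Ioo ht
  have h5 : t⁻¹ * Real.sin (1 * t) / (t⁻¹ * Real.sin (μ * t)) =
      Real.sin t / Real.sin (μ * t) := by
    rw [one_mul]; field_simp
  simp only [Pi.div_apply, h5]
  simp only [one_mul, jacobiU, Real.rpow_zero, mul_one]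
  rw [Real.div_rpow h4.le h3.le]
  field_simp

end

theorem mul_cos_le_sin {x : ℝ} (h0 : 0 ≤ x) (h1 : x ≤ Real.pi / 2) :
    x * Real.cos x ≤ Real.sin x := by
  rcases eq_or_lt_of_le h1 with rfl | h1
  · simp
  · have hc : 0 < Real.cos x := Real.cos_pos_of_mem_Ioo ⟨by linarith [Real.pi_pos], h1⟩
    have := Real.le_tan h0 h1
    rwa [Real.tan_eq_sin_div_cos, le_div_iff₀ hc] at this

/-- The Cusa–Huygens inequality at the double angle. -/
theorem three_mul_sin_mul_cos_le {x : ℝ} (h0 : 0 ≤ x) (h1 : x ≤ Real.pi / 2) :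
    3 * Real.sin x * Real.cos x ≤ x * (1 + 2 * Real.cos x ^ 2) := by
  have hm : MonotoneOn (fun x => x * (1 + 2 * Real.cos x ^ 2) - 3 * Real.sin x * Real.cos x)
      (Icc 0 (Real.pi / 2)) := by
    have hd : ∀ x, HasDerivAt
        (fun x => x * (1 + 2 * Real.cos x ^ 2) - 3 * Real.sin x * Real.cos x)
        (4 * Real.sin x * (Real.sin x - x * Real.cos x)) x := by
      intro x
      refine (((hasDerivAt_id x).mul ((((Real.hasDerivAt_cos x).pow 2).const_mul 2).const_add
        1)).sub (((Real.hasDerivAt_sin x).const_mul 3).mul (Real.hasDerivAt_cos x))).congr_deriv ?_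
      simp only [id, Pi.pow_apply]
      push_cast
      linear_combination -Real.sin_sq_add_cos_sq x
    refine monotoneOn_of_hasDerivWithinAt_nonneg (convex_Icc _ _)
      (fun t _ => (hd t).continuousAt.continuousWithinAt)
      (fun t _ => (hd t).hasDerivWithinAt) fun t ht => ?_
    have ht' := interior_subset ht
    have hs := Real.sin_nonneg_of_nonneg_of_le_pi ht'.1 (by linarith [ht'.2, Real.pi_pos])
    have := mul_cos_le_sin ht'.1 ht'.2
    exact mul_nonneg (by positivity) (by linarith)
  have := hm ⟨le_rfl, by positivity⟩ ⟨h0, h1⟩ h0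
  simp at this
  linarith

theorem antitoneOn_pow_three_mul_cos_div_sin_pow_three :
    AntitoneOn (fun x => x ^ 3 * Real.cos x / Real.sin x ^ 3) (Ioc 0 (Real.pi / 2)) := by
  have hs : ∀ x ∈ Ioc 0 (Real.pi / 2), 0 < Real.sin x := fun x hx =>
    Real.sin_pos_of_pos_of_lt_pi hx.1 (by linarith [hx.2, Real.pi_pos])
  have hd : ∀ x ∈ Ioc 0 (Real.pi / 2),
      HasDerivAt (fun x => x ^ 3 * Real.cos x / Real.sin x ^ 3)
      (x ^ 2 * (3 * Real.sin x * Real.cos x - x * (1 + 2 * Real.cos x ^ 2)) / Real.sin x ^ 4)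
      x := by
    intro x hx
    have h := hs x hx
    refine ((((hasDerivAt_id x).pow 3).mul (Real.hasDerivAt_cos x)).div
      ((Real.hasDerivAt_sin x).pow 3) (by simpa using h.ne')).congr_deriv ?_
    simp only [id, Pi.pow_apply, Pi.mul_apply]
    field_simp
    push_cast
    linear_combination -x ^ 3 * Real.sin x ^ 2 * Real.sin_sq_add_cos_sq x
  refine antitoneOn_of_hasDerivWithinAt_nonpos (convex_Ioc _ _)
    (fun t ht => (hd t ht).continuousAt.continuousWithinAt)
    (fun t ht => (hd t (interior_subset ht)).hasDerivWithinAt) fun t ht => ?_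
  have ht' := interior_subset ht
  have := three_mul_sin_mul_cos_le ht'.1.le ht'.2
  have h := hs t ht'
  refine div_nonpos_of_nonpos_of_nonneg ?_ (by positivity)
  exact mul_nonpos_of_nonneg_of_nonpos (by positivity) (by linarith)

theorem cos_div_sin_pow_three_le {μ t : ℝ} (hμ : 0 < μ) (hμ1 : μ ≤ 1)
    (ht : t ∈ Ioc 0 (Real.pi / 2)) :
    Real.cos t / Real.sin t ^ 3 ≤ μ ^ 3 * (Real.cos (μ * t) / Real.sin (μ * t) ^ 3) := by
  have h0 := ht.1
  have hle : μ * t ≤ t := by nlinarith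
  have := antitoneOn_pow_three_mul_cos_div_sin_pow_three
    (⟨by positivity, hle.trans ht.2⟩ : μ * t ∈ Ioc 0 (Real.pi / 2)) ht hle
  simp only [mul_div_assoc, mul_pow] at this
  rw [mul_comm (μ ^ 3), mul_assoc] at this
  exact le_of_mul_le_mul_left this (by positivity)

theorem mul_sin_le_sin_mul {μ t : ℝ} (hμ : 0 ≤ μ) (hμ1 : μ ≤ 1) (h0 : 0 ≤ t) (h1 : t ≤ Real.pi) :
    μ * Real.sin t ≤ Real.sin (μ * t) := by
  have := strictConcaveOn_sin_Icc.concaveOn.2 (⟨le_rfl, Real.pi_pos.le⟩ : (0 : ℝ) ∈ Icc 0 Real.pi)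
    ⟨h0, h1⟩ (sub_nonneg.2 hμ1) hμ (by ring)
  simpa using this

section
variable {A B M t : ℝ}

theorem jacobiPhi₁_eq (hs : 0 < Real.sin t) (hc : 0 < Real.cos t) :
    jacobiPhi₁ A B t = 2 * (B * Real.sin t ^ 4 - A * Real.cos t ^ 4) /
      (Real.sin t ^ 3 * Real.cos t ^ 3) := by
  unfold jacobiPhi₁
  field_simp
  ring

theorem jacobiPhi₁_neg_iff (hs : 0 < Real.sin t) (hc : 0 < Real.cos t) :
    jacobiPhi₁ A B t < 0 ↔ B * Real.sin t ^ 4 < A * Real.cos t ^ 4 := by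
  rw [jacobiPhi₁_eq hs hc, div_lt_iff₀ (by positivity)]
  constructor <;> intro h <;> linarith

theorem jacobiPhi₁_nonneg_iff (hs : 0 < Real.sin t) (hc : 0 < Real.cos t) :
    0 ≤ jacobiPhi₁ A B t ↔ A * Real.cos t ^ 4 ≤ B * Real.sin t ^ 4 := by
  rw [← not_lt, jacobiPhi₁_neg_iff hs hc, not_lt]

theorem jacobiPhi₁_neg_of_le {t' : ℝ} (hA : 0 ≤ A) (hB : 0 ≤ B) (ht' : 0 < t')
    (ht : t < Real.pi / 2) (hle : t' ≤ t) (h : jacobiPhi₁ A B t < 0) : jacobiPhi₁ A B t' < 0 := by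
  have m : t ∈ Ioo 0 (Real.pi / 2) := ⟨ht'.trans_le hle, ht⟩
  have m' : t' ∈ Ioo 0 (Real.pi / 2) := ⟨ht', hle.trans_lt ht⟩
  have hs := sin_pos_of_mem_Ioo m'
  have hc := cos_pos_of_mem_Ioo m
  rw [jacobiPhi₁_neg_iff (sin_pos_of_mem_Ioo m) hc] at h
  rw [jacobiPhi₁_neg_iff hs (cos_pos_of_mem_Ioo m')]
  have h1 : Real.sin t' ≤ Real.sin t :=
    Real.sin_le_sin_of_le_of_le_pi_div_two (by linarith [Real.pi_pos]) ht.le hle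
  have h2 : Real.cos t ≤ Real.cos t' :=
    Real.cos_le_cos_of_nonneg_of_le_pi ht'.le (by linarith [Real.pi_pos]) hle
  calc B * Real.sin t' ^ 4 ≤ B * Real.sin t ^ 4 := by gcongr
    _ < A * Real.cos t ^ 4 := h
    _ ≤ A * Real.cos t' ^ 4 := by gcongr

theorem jacobiPhi_concave (hM : M ≠ 0) (hA : 0 < A) (hB : 0 ≤ B) (hs : 0 < Real.sin t)
    (hc : 0 ≤ Real.cos t) (h : jacobiPhi₁ A B t ≤ 0) :
    3 * jacobiPhi₁ A B t ^ 2 < 2 * jacobiPhi M A B t * jacobiPhi₂ A B t := by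
  have hc1 : Real.cos t ^ 2 ≤ 1 := Real.cos_sq_le_one t
  have hY : 0 ≤ 2 * B * Real.sin t / Real.cos t ^ 3 := by positivity
  have h1 : jacobiPhi₁ A B t ^ 2 ≤ (2 * A * Real.cos t / Real.sin t ^ 3) ^ 2 := by
    unfold jacobiPhi₁ at h ⊢
    nlinarith
  have h2 : A / Real.sin t ^ 2 < jacobiPhi M A B t := by
    have h3 : 0 ≤ B / Real.cos t ^ 2 := by positivity
    have h4 : 0 < M ^ 2 := by positivity
    unfold jacobiPhi
    linarith
  have h5 : 2 * A * (1 + 2 * Real.cos t ^ 2) / Real.sin t ^ 4 ≤ jacobiPhi₂ A B t := by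
    unfold jacobiPhi₂
    have : 0 ≤ 2 * B * (1 + 2 * Real.sin t ^ 2) / Real.cos t ^ 4 := by positivity
    linarith
  have h6 : 0 < 2 * A * (1 + 2 * Real.cos t ^ 2) / Real.sin t ^ 4 := by positivity
  have h7 : 0 < A / Real.sin t ^ 2 := by positivity
  calc 3 * jacobiPhi₁ A B t ^ 2 ≤ 3 * (2 * A * Real.cos t / Real.sin t ^ 3) ^ 2 := by gcongr
    _ = 4 * A ^ 2 / Real.sin t ^ 6 * (3 * Real.cos t ^ 2) := by ring
    _ ≤ 4 * A ^ 2 / Real.sin t ^ 6 * (1 + 2 * Real.cos t ^ 2) := by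
        gcongr
        linarith
    _ = 2 * (A / Real.sin t ^ 2) * (2 * A * (1 + 2 * Real.cos t ^ 2) / Real.sin t ^ 4) := by
        field_simp
        ring
    _ < 2 * jacobiPhi M A B t * (2 * A * (1 + 2 * Real.cos t ^ 2) / Real.sin t ^ 4) := by gcongr
    _ ≤ 2 * jacobiPhi M A B t * jacobiPhi₂ A B t := by
        have : 0 < jacobiPhi M A B t := h7.trans h2
        gcongr

theorem jacobiPhi_pos (hM : M ≠ 0) (hA : 0 ≤ A) (hB : 0 ≤ B) : 0 < jacobiPhi M A B t := by
  unfold jacobiPhi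
  positivity

/-- The inequality behind the crossing of the slownesses of two Jacobi oscillators. -/
theorem jacobiPhi_crossing {m z : ℝ} (hM : M ≠ 0) (hm : 0 < m) (hA : 0 < A) (hB : 0 < B)
    (ht : t ∈ Ioo 0 (Real.pi / 2)) (hz : z ∈ Ioo 0 (Real.pi / 2)) (hneg : jacobiPhi₁ A B t < 0)
    (hk : A * jacobiPhi M A B t ^ 2 < B * m ^ 4)
    (heq : slowness (jacobiPhi M A B) (jacobiPhi₁ A B) t =
      slowness (jacobiPhi m A 0) (jacobiPhi₁ A 0) z) :
    jacobiPhi₂ A 0 z / jacobiPhi m A 0 z ^ 2 < jacobiPhi₂ A B t / jacobiPhi M A B t ^ 2 := by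
  have hs := sin_pos_of_mem_Ioo ht
  have hc := cos_pos_of_mem_Ioo ht
  have hs' := sin_pos_of_mem_Ioo hz
  have hc' := cos_pos_of_mem_Ioo hz
  have hφ : 0 < jacobiPhi M A B t := jacobiPhi_pos hM hA.le hB.le
  have hψ : 0 < jacobiPhi m A 0 z := jacobiPhi_pos hm.ne' hA.le le_rfl
  have hψm : m ^ 2 ≤ jacobiPhi m A 0 z := by
    unfold jacobiPhi
    have : 0 ≤ A / Real.sin z ^ 2 := by positivity
    simp
    linarith
  have hsc := Real.sin_sq_add_cos_sq z
  have hp : 0 < √(jacobiPhi M A B t) := Real.sqrt_pos.2 hφ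
  have hq : 0 < √(jacobiPhi m A 0 z) := Real.sqrt_pos.2 hψ
  have hp2 := Real.sq_sqrt hφ.le
  have hq2 := Real.sq_sqrt hψ.le
  have hct : Real.cos t ≤ 1 := Real.cos_le_one t
  have hΦ₂ : jacobiPhi₂ A B t = 2 * A * (1 + 2 * Real.cos t ^ 2) / Real.sin t ^ 4 +
    2 * B * (1 + 2 * Real.sin t ^ 2) / Real.cos t ^ 4 := rfl
  have hΨ₂ : jacobiPhi₂ A 0 z = 2 * A * (1 + 2 * Real.cos z ^ 2) / Real.sin z ^ 4 := by
    simp [jacobiPhi₂]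
  have hΨ₁ : jacobiPhi₁ A 0 z = -(2 * A * Real.cos z / Real.sin z ^ 3) := by simp [jacobiPhi₁]
  unfold slowness at heq
  rw [hΨ₁, jacobiPhi₁_eq hs hc] at heq
  rw [jacobiPhi₁_neg_iff hs hc] at hneg
  rw [hΨ₂, hΦ₂]
  generalize jacobiPhi M A B t = φ at *
  generalize jacobiPhi m A 0 z = ψ at *
  generalize √φ = p at *
  generalize √ψ = q at *
  generalize Real.sin t = s at *
  generalize Real.cos t = c at *
  generalize Real.sin z = σ at *
  generalize Real.cos z = γ at *
  subst hp2 hq2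
  have hroot : ∀ y : ℝ, 0 < y → ∃ x, 0 < x ∧ x ^ 3 = y := fun y hy =>
    ⟨y ^ (3⁻¹ : ℝ), by positivity, by
      rw [← Real.rpow_natCast, ← Real.rpow_mul hy.le]; norm_num⟩
  obtain ⟨w, hw, rfl⟩ := hroot γ hc'
  obtain ⟨e, he, hee⟩ := hroot (c - B / A * s ^ 4 / c ^ 3) (by
    rw [sub_pos, div_lt_iff₀ (by positivity), div_mul_eq_mul_div, div_lt_iff₀ hA]
    linarith)
  have hec : e ^ 3 ≤ c := by
    rw [hee]
    have : 0 ≤ B / A * s ^ 4 / c ^ 3 := by positivity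
    linarith
  have hnum : 2 * (B * s ^ 4 - A * c ^ 4) / (s ^ 3 * c ^ 3) = -(2 * A * e ^ 3 / s ^ 3) := by
    rw [hee]
    field_simp
    ring
  rw [hnum] at heq
  have h3 : (e / (s * p)) ^ 3 = (w / (σ * q)) ^ 3 := by
    have e1 : (e / (s * p)) ^ 3 = (-(-(2 * A * e ^ 3 / s ^ 3)) / (2 * (p ^ 2 * p))) / A := by
      field_simp
    have e2 : (w / (σ * q)) ^ 3 = (-(-(2 * A * w ^ 3 / σ ^ 3)) / (2 * (q ^ 2 * q))) / A := by
      field_simp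
    rw [e1, e2, heq]
  have h4 : e / (s * p) = w / (σ * q) :=
    (pow_left_inj₀ (by positivity) (by positivity) (by norm_num)).1 h3
  have h4' : (w / (σ * q)) ^ 4 = (e / (s * p)) ^ 4 := by rw [h4]
  have hlow : 6 * A * (e / (s * p)) ^ 4 + 2 * B / (p ^ 2) ^ 2 ≤
      (2 * A * (1 + 2 * c ^ 2) / s ^ 4 + 2 * B * (1 + 2 * s ^ 2) / c ^ 4) / (p ^ 2) ^ 2 := by
    have e1 : 6 * A * (e / (s * p)) ^ 4 = 2 * A * (3 * e ^ 4) / s ^ 4 / (p ^ 2) ^ 2 := by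
      field_simp
      ring
    have e2 : 3 * e ^ 4 ≤ 1 + 2 * c ^ 2 := by
      have h5 : (e ^ 3) ^ 2 ≤ c ^ 2 := by gcongr
      nlinarith [mul_nonneg (sq_nonneg (e ^ 2 - 1)) (by positivity : 0 ≤ 2 * e ^ 2 + 1)]
    have e3 : 2 * B ≤ 2 * B * (1 + 2 * s ^ 2) / c ^ 4 := by
      rw [le_div_iff₀ (by positivity)]
      have h6 : c ^ 4 ≤ 1 := pow_le_one₀ hc.le hct
      have h7 : 0 ≤ s ^ 2 := sq_nonneg s
      nlinarith
    rw [e1, ← add_div]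
    gcongr
  have hup : 2 * A * (1 + 2 * (w ^ 3) ^ 2) / σ ^ 4 / (q ^ 2) ^ 2 ≤
      6 * A * (w / (σ * q)) ^ 4 + 2 * A / m ^ 4 := by
    have e1 : 2 * A * (1 + 2 * (w ^ 3) ^ 2) / σ ^ 4 / (q ^ 2) ^ 2 = 6 * A * (w / (σ * q)) ^ 4 +
        2 * A * ((1 + 2 * (w ^ 3) ^ 2 - 3 * w ^ 4) / σ ^ 4) / (q ^ 2) ^ 2 := by
      field_simp
      ring
    have e2 : (1 + 2 * (w ^ 3) ^ 2 - 3 * w ^ 4) / σ ^ 4 ≤ 1 := by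
      rw [div_le_one (by positivity)]
      have : σ ^ 4 = (1 - (w ^ 3) ^ 2) ^ 2 := by rw [← hsc]; ring
      rw [this]
      have := mul_nonneg (mul_nonneg (sq_nonneg (w ^ 2)) (sq_nonneg (w ^ 2 - 1)))
        (by positivity : 0 ≤ (w ^ 2) ^ 2 + 2 * w ^ 2 + 3)
      linarith
    have e3 : m ^ 4 ≤ (q ^ 2) ^ 2 := by
      calc m ^ 4 = (m ^ 2) ^ 2 := by ring
        _ ≤ _ := by gcongr
    rw [e1]
    have e4 := mul_le_mul_of_nonneg_left e2 (by positivity : 0 ≤ 2 * A)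
    rw [mul_one] at e4
    have e5 := div_le_div₀ (by positivity : 0 ≤ 2 * A) e4 (by positivity) e3
    linarith
  have hfin : 2 * A / m ^ 4 < 2 * B / (p ^ 2) ^ 2 := by
    rw [div_lt_div_iff₀ (by positivity) (by positivity)]
    linarith
  rw [h4'] at hup
  linarith

end

section
variable {a b : ℝ} {n k : ℕ}

theorem sin_pos_of_mem_Ioc {t : ℝ} (ht : t ∈ Ioc 0 (Real.pi / 2)) : 0 < Real.sin t :=
  Real.sin_pos_of_pos_of_lt_pi ht.1 (by linarith [ht.2, Real.pi_pos])

theorem hasDerivAt_comparator₁ (ha : 0 ≤ a) (k : ℕ) {t : ℝ} (hs : 0 < Real.sin t) :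
    HasDerivAt (jacobiU₁ a 0 k)
      (-(jacobiPhi (2 * k + a) (a * (1 - a)) 0 t * jacobiU a 0 k t)) t := by
  simpa using hasDerivAt_jacobiU₁ (b := 0) k ha hs (Or.inr rfl)

theorem hasDerivAt_jacobi_wronskian (ha : 0 ≤ a) {μ t : ℝ} (hs : 0 < Real.sin t)
    (hc : 0 < Real.cos t) (hs' : 0 < Real.sin (μ * t)) :
    HasDerivAt (fun t => jacobiU₁ a b n t * jacobiU a 0 k (μ * t) -
      jacobiU a b n t * (μ * jacobiU₁ a 0 k (μ * t)))
      ((μ ^ 2 * jacobiPhi (2 * k + a) (a * (1 - a)) 0 (μ * t) -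
        jacobiPhi (2 * n + a + b) (a * (1 - a)) (b * (1 - b)) t) *
        (jacobiU a b n t * jacobiU a 0 k (μ * t))) t := by
  have hμ : HasDerivAt (fun t => μ * t) μ t := by
    simpa using (hasDerivAt_id t).const_mul μ
  have hV := (hasDerivAt_jacobiU (a := a) (b := 0) k hs' (Or.inr rfl)).comp t hμ
  have hV₁ := (hasDerivAt_comparator₁ ha k hs').comp t hμ
  have hU := hasDerivAt_jacobiU (a := a) (b := b) n hs (Or.inl hc)
  have hU₁ := hasDerivAt_jacobiU₁ (a := a) (b := b) n ha hs (Or.inl hc)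
  refine ((hU₁.mul hV).sub (hU.mul (hV₁.const_mul μ))).congr_deriv ?_
  simp only [Function.comp]
  ring

theorem pos_of_eventually_pos_of_deriv_nonneg {f f' : ℝ → ℝ} {T : ℝ}
    (h0 : ∀ᶠ t in 𝓝[>] 0, 0 < f t) (hd : ∀ t ∈ Ioc 0 T, HasDerivAt f (f' t) t)
    (hf : ∀ t ∈ Ioo 0 T, 0 < f' t) : ∀ t ∈ Ioc 0 T, 0 < f t := by
  intro t ht
  obtain ⟨ε, hε, hε'⟩ := (h0.and (eventually_nhdsGT_zero_mem_Ioo ht.1)).exists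
  have := monotoneOn_of_hasDerivWithinAt_nonneg (convex_Ioc 0 T)
    (fun t ht => (hd t ht).continuousAt.continuousWithinAt)
    (fun t ht => (hd t (interior_subset ht)).hasDerivWithinAt)
    (fun t ht => (hf t (by rwa [interior_Ioc] at ht)).le)
  exact hε.trans_le (this ⟨hε'.1, hε'.2.le.trans ht.2⟩ ht hε'.2.le)

theorem jacobiU_pos {T : ℝ} (hT : T < Real.pi / 2) (h : ∀ t ∈ Ioo 0 T, 0 < jacobiU₁ a b n t) :
    ∀ t ∈ Ioc 0 T, 0 < jacobiU a b n t :=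
  pos_of_eventually_pos_of_deriv_nonneg (eventually_jacobiU_pos n)
    (fun _ ht => hasDerivAt_jacobiU n (sin_pos_of_mem_Ioo ⟨ht.1, ht.2.trans_lt hT⟩)
      (Or.inl (cos_pos_of_mem_Ioo ⟨ht.1, ht.2.trans_lt hT⟩))) h

theorem comparator_pos {T : ℝ} (hT : T ≤ Real.pi / 2) (h : ∀ t ∈ Ioo 0 T, 0 < jacobiU₁ a 0 k t) :
    ∀ t ∈ Ioc 0 T, 0 < jacobiU a 0 k t :=
  pos_of_eventually_pos_of_deriv_nonneg (eventually_jacobiU_pos k)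
    (fun _ ht => hasDerivAt_jacobiU k (sin_pos_of_mem_Ioc ⟨ht.1, ht.2.trans hT⟩) (Or.inr rfl)) h

theorem comparator₁_pi_div_two : jacobiU₁ a 0 k (Real.pi / 2) = 0 := by
  simp [jacobiU₁, weightLogDeriv]

theorem exists_comparator_critical (ha : 0 < a) (k : ℕ) :
    ∃ z ∈ Ioc 0 (Real.pi / 2), jacobiU₁ a 0 k z = 0 ∧ ∀ t ∈ Ioo 0 z, 0 < jacobiU₁ a 0 k t :=
  exists_first_zero (by positivity)
    (fun t ht => (hasDerivAt_comparator₁ ha.le k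
      (sin_pos_of_mem_Ioc ht)).continuousAt.continuousWithinAt)
    (eventually_jacobiU₁_pos ha k) comparator₁_pi_div_two.le

variable {z₁ t₁ : ℝ}

theorem comparator_critical_le (ha : 0 < a) (ht₁ : t₁ ∈ Ioo 0 (Real.pi / 2))
    (hU₁ : jacobiU₁ a b n t₁ = 0) (hU : ∀ t ∈ Ioo 0 t₁, 0 < jacobiU₁ a b n t)
    (hz₁ : z₁ ∈ Ioc 0 (Real.pi / 2)) (hV : ∀ t ∈ Ioo 0 z₁, 0 < jacobiU₁ a 0 k t)
    (hle : ∀ t ∈ Ioc 0 t₁, jacobiPhi (2 * n + a + b) (a * (1 - a)) (b * (1 - b)) t ≤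
      jacobiPhi (2 * k + a) (a * (1 - a)) 0 t) : z₁ ≤ t₁ := by
  by_contra! hcon
  have hUp := jacobiU_pos ht₁.2 hU
  have hVp := comparator_pos hz₁.2 hV
  have hm : ∀ t ∈ Ioc 0 t₁, t ∈ Ioo 0 (Real.pi / 2) := fun t ht => ⟨ht.1, ht.2.trans_lt ht₁.2⟩
  have := le_of_tendsto_of_deriv_nonneg ht₁.1
    (tendsto_jacobi_wronskian (b := b) ha n k one_pos le_rfl)
    (fun t ht => hasDerivAt_jacobi_wronskian ha.le (sin_pos_of_mem_Ioo (hm t ht))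
      (cos_pos_of_mem_Ioo (hm t ht)) (by simpa using sin_pos_of_mem_Ioo (hm t ht)))
    (fun t ht => by
      have h1 := hUp t ht
      have h2 := hVp t ⟨ht.1, ht.2.trans hcon.le⟩
      have h3 := hle t ht
      simp only [one_pow, one_mul]
      exact mul_nonneg (by linarith) (by positivity))
  have h1 := hUp t₁ ⟨ht₁.1, le_rfl⟩
  have h2 := hV t₁ ⟨ht₁.1, hcon⟩
  have h3 := mul_pos h1 h2
  simp only [hU₁, one_mul] at this
  linarith

theorem scaled_comparison (ha : 0 < a) (ha1 : a ≤ 1) (hb : 0 ≤ b) (hb1 : b ≤ 1) {ν T : ℝ}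
    (hν : 0 < ν) (hν1 : ν ≤ 1) (hνm : ν * (2 * k + a) = 2 * n + a + b)
    (hT : T ∈ Ioo 0 (Real.pi / 2)) (hU : ∀ t ∈ Ioo 0 T, 0 < jacobiU₁ a b n t)
    (hz₁ : z₁ ∈ Ioc 0 (Real.pi / 2)) (hVz : jacobiU₁ a 0 k z₁ = 0)
    (hV : ∀ t ∈ Ioo 0 z₁, 0 < jacobiU₁ a 0 k t) :
    ν * T ≤ z₁ ∧ jacobiU a b n T ≤ ν⁻¹ ^ a * jacobiU a 0 k (ν * T) ∧
      jacobiU₁ a b n T ≤ ν⁻¹ ^ a * (ν * jacobiU₁ a 0 k (ν * T)) ∧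
      ν ^ 2 * jacobiPhi (2 * k + a) (a * (1 - a)) 0 (ν * T) ≤
        jacobiPhi (2 * n + a + b) (a * (1 - a)) (b * (1 - b)) T := by
  have hUp := jacobiU_pos hT.2 hU
  have hVp := comparator_pos hz₁.2 hV
  have hm : ∀ t ∈ Ioc 0 T, t ∈ Ioo 0 (Real.pi / 2) := fun t ht => ⟨ht.1, ht.2.trans_lt hT.2⟩
  have hm' : ∀ t ∈ Ioc 0 T, ν * t ∈ Ioo 0 (Real.pi / 2) := fun t ht => by
    have := hm t ht
    exact ⟨mul_pos hν this.1, by nlinarith [this.1, this.2]⟩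
  have hA : 0 ≤ a * (1 - a) := mul_nonneg ha.le (by linarith)
  have hB : 0 ≤ b * (1 - b) := mul_nonneg hb (by linarith)
  have hphi : ∀ t ∈ Ioc 0 T, ν ^ 2 * jacobiPhi (2 * k + a) (a * (1 - a)) 0 (ν * t) ≤
      jacobiPhi (2 * n + a + b) (a * (1 - a)) (b * (1 - b)) t := by
    intro t ht
    have hs := sin_pos_of_mem_Ioo (hm t ht)
    have hs' := sin_pos_of_mem_Ioo (hm' t ht)
    have hle := mul_sin_le_sin_mul hν.le hν1 ht.1.le (by linarith [(hm t ht).2, Real.pi_pos])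
    have h1 : ν ^ 2 * (a * (1 - a) / Real.sin (ν * t) ^ 2) ≤ a * (1 - a) / Real.sin t ^ 2 := by
      rw [← mul_div_assoc, div_le_div_iff₀ (by positivity) (by positivity)]
      calc _ = a * (1 - a) * (ν * Real.sin t) ^ 2 := by ring
        _ ≤ _ := by gcongr
    have h2 : 0 ≤ b * (1 - b) / Real.cos t ^ 2 := by positivity
    unfold jacobiPhi
    rw [← hνm]
    simp only [zero_div, add_zero]
    nlinarith
  have hW : ∀ T' ∈ Ioc 0 T, ν * T' ≤ z₁ → jacobiU₁ a b n T' * jacobiU a 0 k (ν * T') ≤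
      jacobiU a b n T' * (ν * jacobiU₁ a 0 k (ν * T')) := by
    intro T' hT' hle
    have hmem : ∀ t ∈ Ioc 0 T', t ∈ Ioc 0 T := fun t ht => ⟨ht.1, ht.2.trans hT'.2⟩
    have := le_of_tendsto_of_deriv_nonneg hT'.1
      (tendsto_jacobi_wronskian (b := b) ha n k hν hν1).neg
      (fun t ht => (hasDerivAt_jacobi_wronskian ha.le (sin_pos_of_mem_Ioo (hm t (hmem t ht)))
        (cos_pos_of_mem_Ioo (hm t (hmem t ht))) (sin_pos_of_mem_Ioo (hm' t (hmem t ht)))).neg)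
      (fun t ht => by
        have h1 := hUp t (hmem t ht)
        have h2 := hVp (ν * t) ⟨mul_pos hν ht.1, le_trans (by gcongr; exact ht.2) hle⟩
        have h3 := hphi t (hmem t ht)
        rw [← neg_mul]
        exact mul_nonneg (by linarith) (by positivity))
    linarith
  have hνT : ν * T ≤ z₁ := by
    by_contra! hcon
    have hlt : z₁ / ν < T := by rwa [div_lt_iff₀ hν, mul_comm]
    have hpos : 0 < z₁ / ν := div_pos hz₁.1 hν
    have heq : ν * (z₁ / ν) = z₁ := by field_simp
    have := hW (z₁ / ν) ⟨hpos, hlt.le⟩ heq.le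
    rw [heq, hVz] at this
    have := mul_pos (hU _ ⟨hpos, hlt⟩) (hVp z₁ ⟨hz₁.1, le_rfl⟩)
    linarith
  have hle : ∀ t ∈ Ioc 0 T, ν * t ∈ Ioc 0 z₁ := fun t ht =>
    ⟨mul_pos hν ht.1, le_trans (by gcongr; exact ht.2) hνT⟩
  have hTT : T ∈ Ioc 0 T := ⟨hT.1, le_rfl⟩
  have hVT := hVp _ (hle T hTT)
  have hUle : jacobiU a b n T ≤ ν⁻¹ ^ a * jacobiU a 0 k (ν * T) := by
    have hd : ∀ t ∈ Ioc 0 T, HasDerivAt (fun t => -(jacobiU a b n t / jacobiU a 0 k (ν * t)))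
        ((jacobiU a b n t * (ν * jacobiU₁ a 0 k (ν * t)) -
          jacobiU₁ a b n t * jacobiU a 0 k (ν * t)) / jacobiU a 0 k (ν * t) ^ 2) t := by
      intro t ht
      have hμ : HasDerivAt (fun t => ν * t) ν t := by
        simpa using (hasDerivAt_id t).const_mul ν
      have h1 := (hasDerivAt_jacobiU (a := a) (b := 0) k (sin_pos_of_mem_Ioo (hm' t ht))
        (Or.inr rfl)).comp t hμ
      have h2 := hasDerivAt_jacobiU (a := a) (b := b) n (sin_pos_of_mem_Ioo (hm t ht))
        (Or.inl (cos_pos_of_mem_Ioo (hm t ht)))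
      refine (h2.div h1 (hVp _ (hle t ht)).ne').neg.congr_deriv ?_
      simp only [Function.comp]
      ring
    have := le_of_tendsto_of_deriv_nonneg hT.1 (tendsto_jacobi_ratio (b := b) n k hν).neg hd
      (fun t ht => div_nonneg (by linarith [hW t ht (hle t ht).2]) (sq_nonneg _))
    rw [← div_le_iff₀ hVT]
    linarith
  refine ⟨hνT, hUle, ?_, hphi T hTT⟩
  have hV₁T : 0 ≤ jacobiU₁ a 0 k (ν * T) := by
    rcases eq_or_lt_of_le hνT with h | h
    · rw [h, hVz]
    · exact (hV _ ⟨mul_pos hν hT.1, h⟩).le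
  have h1 := hW T hTT hνT
  have h2 := mul_le_mul_of_nonneg_right hUle (mul_nonneg hν.le hV₁T)
  refine le_of_mul_le_mul_right ?_ hVT
  linarith

theorem critical_slowness_le (ha : 0 < a) (ha1 : a < 1) (hb : 0 < b) (hb1 : b < 1) (hk : 1 ≤ k)
    (ht₁ : t₁ ∈ Ioo 0 (Real.pi / 2))
    (hneg : jacobiPhi₁ (a * (1 - a)) (b * (1 - b)) t₁ < 0)
    (hU₁ : jacobiU₁ a b n t₁ = 0) (hU : ∀ t ∈ Ioo 0 t₁, 0 < jacobiU₁ a b n t)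
    (hz₁ : z₁ ∈ Ioc 0 (Real.pi / 2)) (hVz : jacobiU₁ a 0 k z₁ = 0)
    (hV : ∀ t ∈ Ioo 0 z₁, 0 < jacobiU₁ a 0 k t) (hle : z₁ ≤ t₁) :
    slowness (jacobiPhi (2 * n + a + b) (a * (1 - a)) (b * (1 - b)))
        (jacobiPhi₁ (a * (1 - a)) (b * (1 - b))) t₁ ≤
      slowness (jacobiPhi (2 * k + a) (a * (1 - a)) 0) (jacobiPhi₁ (a * (1 - a)) 0) z₁ := by
  have hA : 0 < a * (1 - a) := mul_pos ha (by linarith)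
  have hB : 0 < b * (1 - b) := mul_pos hb (by linarith)
  have hUp := jacobiU_pos ht₁.2 hU
  have hVp := comparator_pos hz₁.2 hV
  set A := a * (1 - a) with hAdef
  set B := b * (1 - b) with hBdef
  obtain ⟨μ, hμdef⟩ : ∃ μ, μ = z₁ / t₁ := ⟨_, rfl⟩
  have hμ : 0 < μ := hμdef ▸ div_pos hz₁.1 ht₁.1
  have hμ1 : μ ≤ 1 := by rw [hμdef, div_le_one ht₁.1]; exact hle
  have hμt : μ * t₁ = z₁ := by
    have := ht₁.1.ne'
    rw [hμdef]; field_simp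
  have hm : ∀ t ∈ Ioc 0 t₁, t ∈ Ioo 0 (Real.pi / 2) := fun t ht => ⟨ht.1, ht.2.trans_lt ht₁.2⟩
  have hm' : ∀ t ∈ Ioc 0 t₁, μ * t ∈ Ioo 0 (Real.pi / 2) := fun t ht => by
    have := hm t ht
    exact ⟨mul_pos hμ this.1, by nlinarith [this.1, this.2]⟩
  have hz : ∀ t ∈ Ioc 0 t₁, μ * t ∈ Ioc 0 z₁ := fun t ht =>
    ⟨mul_pos hμ ht.1, hμt ▸ by gcongr; exact ht.2⟩
  have hphi₁ : ∀ t ∈ Ioc 0 t₁, μ ^ 3 * jacobiPhi₁ A 0 (μ * t) ≤ jacobiPhi₁ A B t := by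
    intro t ht
    have hs := sin_pos_of_mem_Ioo (hm t ht)
    have hc := cos_pos_of_mem_Ioo (hm t ht)
    have h1 := mul_le_mul_of_nonneg_left (cos_div_sin_pow_three_le hμ hμ1
      ⟨ht.1, (hm t ht).2.le⟩) (by positivity : 0 ≤ 2 * A)
    have h2 : 0 ≤ 2 * B * Real.sin t / Real.cos t ^ 3 := by positivity
    unfold jacobiPhi₁
    simp only [mul_zero, zero_mul, zero_div, add_zero]
    rw [mul_div_assoc, mul_div_assoc]
    linarith
  have ht₁m : t₁ ∈ Ioc 0 t₁ := ⟨ht₁.1, le_rfl⟩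
  have hphi : μ ^ 2 * jacobiPhi (2 * k + a) A 0 z₁ ≤ jacobiPhi (2 * n + a + b) A B t₁ := by
    by_contra! hcon
    have hdd : ∀ t ∈ Ioc 0 t₁, HasDerivAt (fun t => μ ^ 2 * jacobiPhi (2 * k + a) A 0 (μ * t) -
        jacobiPhi (2 * n + a + b) A B t)
        (μ ^ 3 * jacobiPhi₁ A 0 (μ * t) - jacobiPhi₁ A B t) t := by
      intro t ht
      have hμ' : HasDerivAt (fun t => μ * t) μ t := by
        simpa using (hasDerivAt_id t).const_mul μ
      have h1 := (hasDerivAt_jacobiPhi (A := A) (B := 0) (2 * k + a)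
        (sin_pos_of_mem_Ioo (hm' t ht)) (Or.inr rfl)).comp t hμ'
      refine ((h1.const_mul (μ ^ 2)).sub (hasDerivAt_jacobiPhi (2 * n + a + b)
        (sin_pos_of_mem_Ioo (hm t ht)) (Or.inl (cos_pos_of_mem_Ioo (hm t ht))))).congr_deriv ?_
      ring
    have hanti := antitoneOn_of_hasDerivWithinAt_nonpos (convex_Ioc 0 t₁)
      (fun t ht => (hdd t ht).continuousAt.continuousWithinAt)
      (fun t ht => (hdd t (interior_subset ht)).hasDerivWithinAt)
      (fun t ht => sub_nonpos.2 (hphi₁ t (interior_subset ht)))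
    have hpos : ∀ t ∈ Ioc 0 t₁, 0 < (μ ^ 2 * jacobiPhi (2 * k + a) A 0 (μ * t) -
        jacobiPhi (2 * n + a + b) A B t) * (jacobiU a b n t * jacobiU a 0 k (μ * t)) := by
      intro t ht
      have h1 := hanti ht ht₁m ht.2
      simp only [hμt] at h1
      have h2 := hUp t ht
      have h3 := hVp _ (hz t ht)
      exact mul_pos (by linarith) (by positivity)
    have hWd := fun t (ht : t ∈ Ioc 0 t₁) => hasDerivAt_jacobi_wronskian (a := a) (b := b) (n := n)
      (k := k) ha.le (sin_pos_of_mem_Ioo (hm t ht)) (cos_pos_of_mem_Ioo (hm t ht))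
      (sin_pos_of_mem_Ioo (hm' t ht))
    have hhalf : t₁ / 2 ∈ Ioc 0 t₁ := ⟨by linarith [ht₁.1], by linarith [ht₁.1]⟩
    have h0 := le_of_tendsto_of_deriv_nonneg hhalf.1
      (tendsto_jacobi_wronskian (b := b) ha n k hμ hμ1)
      (fun t ht => hWd t ⟨ht.1, ht.2.trans hhalf.2⟩)
      (fun t ht => (hpos t ⟨ht.1, ht.2.trans hhalf.2⟩).le)
    have hmono := strictMonoOn_of_hasDerivWithinAt_pos (convex_Ioc 0 t₁)
      (fun t ht => (hWd t ht).continuousAt.continuousWithinAt)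
      (fun t ht => (hWd t (interior_subset ht)).hasDerivWithinAt)
      (fun t ht => hpos t (interior_subset ht))
    have h1 := hmono hhalf ht₁m (by linarith [ht₁.1])
    simp only [hμt, hU₁, hVz] at h1
    linarith
  have hψ : 0 < jacobiPhi (2 * k + a) A 0 z₁ := jacobiPhi_pos (by positivity) hA.le le_rfl
  have hφ : 0 < jacobiPhi (2 * n + a + b) A B t₁ := jacobiPhi_pos (by positivity) hA.le hB.le
  have h1 := hphi₁ t₁ ht₁m
  rw [hμt] at h1
  unfold slowness
  have hsq : √(μ ^ 2 * jacobiPhi (2 * k + a) A 0 z₁) = μ * √(jacobiPhi (2 * k + a) A 0 z₁) := by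
    rw [Real.sqrt_mul (sq_nonneg μ), Real.sqrt_sq hμ.le]
  have hsqle := Real.sqrt_le_sqrt hphi
  rw [hsq] at hsqle
  have hq := Real.sqrt_pos.2 hψ
  calc _ ≤ -(μ ^ 3 * jacobiPhi₁ A 0 z₁) / (2 * ((μ ^ 2 * jacobiPhi (2 * k + a) A 0 z₁) *
        (μ * √(jacobiPhi (2 * k + a) A 0 z₁)))) := by
        apply div_le_div₀ (by linarith) (by linarith) (by positivity)
        gcongr
    _ = _ := by field_simp

end

section
variable {a b : ℝ} {n : ℕ}

theorem isOscillator_jacobi (ha : 0 < a) (ha1 : a < 1) (hb : 0 ≤ b) (hb1 : b ≤ 1) (n : ℕ) {s : Set ℝ}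
    (hs : s ⊆ Ioo 0 (Real.pi / 2)) (hneg : ∀ t ∈ s, jacobiPhi₁ (a * (1 - a)) (b * (1 - b)) t ≤ 0) :
    IsOscillator (jacobiPhi (2 * n + a + b) (a * (1 - a)) (b * (1 - b)))
      (jacobiPhi₁ (a * (1 - a)) (b * (1 - b))) (jacobiPhi₂ (a * (1 - a)) (b * (1 - b)))
      (jacobiU a b n) (jacobiU₁ a b n) s where
  pos _ _ := jacobiPhi_pos (by positivity) (mul_nonneg ha.le (by linarith))
    (mul_nonneg hb (by linarith))
  hasDerivAt_phi _ ht := hasDerivAt_jacobiPhi _ (sin_pos_of_mem_Ioo (hs ht))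
    (Or.inl (cos_pos_of_mem_Ioo (hs ht)))
  hasDerivAt_phi₁ _ ht := hasDerivAt_jacobiPhi₁ (sin_pos_of_mem_Ioo (hs ht))
    (Or.inl (cos_pos_of_mem_Ioo (hs ht)))
  hasDerivAt_U _ ht := hasDerivAt_jacobiU n (sin_pos_of_mem_Ioo (hs ht))
    (Or.inl (cos_pos_of_mem_Ioo (hs ht)))
  hasDerivAt_U₁ _ ht := hasDerivAt_jacobiU₁ n ha.le (sin_pos_of_mem_Ioo (hs ht))
    (Or.inl (cos_pos_of_mem_Ioo (hs ht)))
  concave t ht := jacobiPhi_concave (by positivity) (mul_pos ha (by linarith))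
    (mul_nonneg hb (by linarith)) (sin_pos_of_mem_Ioo (hs ht)) (cos_pos_of_mem_Ioo (hs ht)).le
    (hneg t ht)

theorem jacobiPhi₁_comparator {A t : ℝ} :
    jacobiPhi₁ A 0 t = -(2 * A * Real.cos t / Real.sin t ^ 3) := by
  simp [jacobiPhi₁]

theorem isOscillator_comparator (ha : 0 < a) (ha1 : a < 1) (k : ℕ) {s : Set ℝ}
    (hs : s ⊆ Ioc 0 (Real.pi / 2)) :
    IsOscillator (jacobiPhi (2 * k + a) (a * (1 - a)) 0) (jacobiPhi₁ (a * (1 - a)) 0)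
      (jacobiPhi₂ (a * (1 - a)) 0) (jacobiU a 0 k) (jacobiU₁ a 0 k) s := by
  have hA : 0 < a * (1 - a) := mul_pos ha (by linarith)
  have hc : ∀ t ∈ s, 0 ≤ Real.cos t := fun t ht =>
    Real.cos_nonneg_of_mem_Icc ⟨by linarith [(hs ht).1, Real.pi_pos], (hs ht).2⟩
  exact
    { pos := fun _ _ => jacobiPhi_pos (by positivity) hA.le le_rfl
      hasDerivAt_phi := fun _ ht => hasDerivAt_jacobiPhi _ (sin_pos_of_mem_Ioc (hs ht)) (Or.inr rfl)
      hasDerivAt_phi₁ := fun _ ht => hasDerivAt_jacobiPhi₁ (sin_pos_of_mem_Ioc (hs ht)) (Or.inr rfl)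
      hasDerivAt_U := fun _ ht => hasDerivAt_jacobiU k (sin_pos_of_mem_Ioc (hs ht)) (Or.inr rfl)
      hasDerivAt_U₁ := fun _ ht => hasDerivAt_comparator₁ ha.le k (sin_pos_of_mem_Ioc (hs ht))
      concave := fun t ht => by
        have h1 := sin_pos_of_mem_Ioc (hs ht)
        have h2 := hc t ht
        refine jacobiPhi_concave (by positivity) hA le_rfl h1 h2 ?_
        rw [jacobiPhi₁_comparator, neg_nonpos]
        positivity }

theorem jacobiPhi₁_comparator_neg {A t : ℝ} (hA : 0 < A) (ht : t ∈ Ioo 0 (Real.pi / 2)) :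
    jacobiPhi₁ A 0 t < 0 := by
  have h1 := sin_pos_of_mem_Ioo ht
  have h2 := cos_pos_of_mem_Ioo ht
  rw [jacobiPhi₁_comparator, neg_lt_zero]
  positivity

theorem jacobiPhi₁_comparator_pi_div_two {A : ℝ} : jacobiPhi₁ A 0 (Real.pi / 2) = 0 := by
  simp [jacobiPhi₁]

theorem sonin_comparator_pi_div_two {k : ℕ} {φ : ℝ → ℝ} :
    sonin φ (jacobiU a 0 k) (jacobiU₁ a 0 k) (Real.pi / 2) = (jacobiPoly a 0 k).eval 1 ^ 2 := by
  simp [sonin, comparator₁_pi_div_two, jacobiU]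

theorem sonin_comparator_le (ha : 0 < a) (ha1 : a < 1) (k : ℕ) {z : ℝ}
    (hz : z ∈ Ioc 0 (Real.pi / 2)) :
    sonin (jacobiPhi (2 * k + a) (a * (1 - a)) 0) (jacobiU a 0 k) (jacobiU₁ a 0 k) z ≤
      (jacobiPoly a 0 k).eval 1 ^ 2 := by
  have hA : 0 < a * (1 - a) := mul_pos ha (by linarith)
  have hsub : Icc z (Real.pi / 2) ⊆ Ioc 0 (Real.pi / 2) := fun t ht => ⟨hz.1.trans_le ht.1, ht.2⟩
  rw [← sonin_comparator_pi_div_two (φ := jacobiPhi (2 * k + a) (a * (1 - a)) 0)]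
  refine (isOscillator_comparator ha ha1 k hsub).sonin_monotoneOn (fun t ht => ?_)
    ⟨le_rfl, hz.2⟩ ⟨hz.2, le_rfl⟩ hz.2
  rcases eq_or_lt_of_le ht.2 with h | h
  · rw [h, jacobiPhi₁_comparator_pi_div_two]
  · exact (jacobiPhi₁_comparator_neg hA ⟨hz.1.trans_le ht.1, h⟩).le

theorem sonin_le_of_noncritical (ha : 0 < a) (ha1 : a < 1) (hb : 0 ≤ b) (hb1 : b ≤ 1) {k : ℕ} {t : ℝ}
    (hk : 2 * n + a + b ≤ 2 * k + a) (ht : t ∈ Ioo 0 (Real.pi / 2))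
    (hU : ∀ s ∈ Ioc 0 t, 0 < jacobiU₁ a b n s) :
    sonin (jacobiPhi (2 * n + a + b) (a * (1 - a)) (b * (1 - b))) (jacobiU a b n)
        (jacobiU₁ a b n) t ≤
      (((2 * k + a) / (2 * n + a + b)) ^ a) ^ 2 * (jacobiPoly a 0 k).eval 1 ^ 2 := by
  obtain ⟨z, hz, hVz, hV⟩ := exists_comparator_critical ha k
  have hA : 0 < a * (1 - a) := mul_pos ha (by linarith)
  have hM : 0 < 2 * n + a + b := by positivity
  have hm : 0 < 2 * k + a := by positivity
  obtain ⟨ν, hν⟩ : ∃ ν, ν = (2 * n + a + b) / (2 * k + a) := ⟨_, rfl⟩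
  have hν0 : 0 < ν := hν ▸ div_pos hM hm
  have hν1 : ν ≤ 1 := by rw [hν, div_le_one hm]; exact hk
  have hUp := jacobiU_pos (b := b) (n := n) ht.2 (fun s hs => hU s ⟨hs.1, hs.2.le⟩) t ⟨ht.1, le_rfl⟩
  obtain ⟨h1, h2, h3, h4⟩ := scaled_comparison (b := b) (n := n) (k := k) ha ha1.le hb hb1 hν0 hν1
    (by rw [hν]; field_simp) ht (fun s hs => hU s ⟨hs.1, hs.2.le⟩) hz hVz hV
  have hinv : (2 * k + a) / (2 * n + a + b) = ν⁻¹ := by rw [hν, inv_div]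
  rw [hinv]
  have hνt : ν * t ∈ Ioc 0 (Real.pi / 2) := ⟨mul_pos hν0 ht.1, h1.trans hz.2⟩
  have hψ : 0 < jacobiPhi (2 * k + a) (a * (1 - a)) 0 (ν * t) :=
    jacobiPhi_pos hm.ne' hA.le le_rfl
  refine le_trans ?_ (mul_le_mul_of_nonneg_left (sonin_comparator_le ha ha1 k hνt) (sq_nonneg _))
  unfold sonin
  have h5 := hU t ⟨ht.1, le_rfl⟩
  calc _ ≤ (ν⁻¹ ^ a * jacobiU a 0 k (ν * t)) ^ 2 + (ν⁻¹ ^ a * (ν * jacobiU₁ a 0 k (ν * t))) ^ 2 /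
        (ν ^ 2 * jacobiPhi (2 * k + a) (a * (1 - a)) 0 (ν * t)) := by
        gcongr
    _ = _ := by field_simp

theorem sonin_le_of_critical (ha : 0 < a) (ha1 : a < 1) (hb : 0 < b) (hb1 : b < 1) {k : ℕ} {t t₁ : ℝ}
    (hk1 : 1 ≤ k) (hk : 2 * n + a + b ≤ 2 * k + a) (ht : t ∈ Ioo 0 (Real.pi / 2))
    (hneg : jacobiPhi₁ (a * (1 - a)) (b * (1 - b)) t < 0)
    (ht₁ : t₁ ∈ Ioc 0 t) (hU₁ : jacobiU₁ a b n t₁ = 0) (hU : ∀ s ∈ Ioo 0 t₁, 0 < jacobiU₁ a b n s)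
    (hkc : (2 * n + a + b) ^ 2 + b * (1 - b) / Real.cos t ^ 2 ≤ (2 * k + a) ^ 2)
    (hkq : a * (1 - a) * ((2 * n + a + b) ^ 2 + a * (1 - a) / Real.sin t₁ ^ 2 +
      b * (1 - b) / Real.cos t ^ 2) ^ 2 < b * (1 - b) * (2 * k + a) ^ 4) :
    sonin (jacobiPhi (2 * n + a + b) (a * (1 - a)) (b * (1 - b))) (jacobiU a b n)
        (jacobiU₁ a b n) t ≤
      (((2 * k + a) / (2 * n + a + b)) ^ a) ^ 2 * (jacobiPoly a 0 k).eval 1 ^ 2 := by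
  obtain ⟨z, hz, hVz, hV⟩ := exists_comparator_critical ha k
  have hA : 0 < a * (1 - a) := mul_pos ha (by linarith)
  have hB : 0 < b * (1 - b) := mul_pos hb (by linarith)
  have hM : 0 < 2 * n + a + b := by positivity
  have hm : 0 < 2 * k + a := by positivity
  have hmem : ∀ s ∈ Ioc 0 t, s ∈ Ioo 0 (Real.pi / 2) := fun s hs => ⟨hs.1, hs.2.trans_lt ht.2⟩
  have ht₁' := hmem t₁ ht₁
  have hsub : Icc t₁ t ⊆ Ioo 0 (Real.pi / 2) := fun s hs => hmem s ⟨ht₁.1.trans_le hs.1, hs.2⟩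
  have hsub' : Icc z (Real.pi / 2) ⊆ Ioc 0 (Real.pi / 2) := fun t ht => ⟨hz.1.trans_le ht.1, ht.2⟩
  have hnegs : ∀ s ∈ Ioc 0 t, jacobiPhi₁ (a * (1 - a)) (b * (1 - b)) s < 0 := fun s hs =>
    jacobiPhi₁_neg_of_le hA.le hB.le hs.1 ht.2 hs.2 hneg
  have hcos : ∀ s ∈ Ioc 0 t, b * (1 - b) / Real.cos s ^ 2 ≤ b * (1 - b) / Real.cos t ^ 2 := by
    intro s hs
    have h1 := cos_pos_of_mem_Ioo ht
    have h2 := Real.cos_le_cos_of_nonneg_of_le_pi hs.1.le (by linarith [ht.2, Real.pi_pos]) hs.2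
    gcongr
  have hle : z ≤ t₁ := by
    refine comparator_critical_le ha ht₁' hU₁ hU hz hV (fun s hs => ?_)
    have := hcos s ⟨hs.1, hs.2.trans ht₁.2⟩
    simp only [jacobiPhi, zero_div, add_zero]
    linarith
  obtain ⟨ν, hν⟩ : ∃ ν, ν = (2 * n + a + b) / (2 * k + a) := ⟨_, rfl⟩
  have hν0 : 0 < ν := hν ▸ div_pos hM hm
  have hν1 : ν ≤ 1 := by rw [hν, div_le_one hm]; exact hk
  obtain ⟨h1, h2, -, -⟩ := scaled_comparison (b := b) (n := n) (k := k) ha ha1.le hb.le hb1.le hν0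
    hν1 (by rw [hν]; field_simp) ht₁' hU hz hVz hV
  have hinv : (2 * k + a) / (2 * n + a + b) = ν⁻¹ := by rw [hν, inv_div]
  rw [hinv]
  have hVp := comparator_pos hz.2 hV
  have hVmono : jacobiU a 0 k (ν * t₁) ≤ jacobiU a 0 k z :=
    monotoneOn_of_hasDerivWithinAt_nonneg (convex_Ioc 0 z)
      (fun s hs => (hasDerivAt_jacobiU k (sin_pos_of_mem_Ioc ⟨hs.1, hs.2.trans hz.2⟩)
        (Or.inr rfl)).continuousAt.continuousWithinAt)
      (fun s hs => (hasDerivAt_jacobiU k (sin_pos_of_mem_Ioc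
        ⟨(interior_subset hs).1, (interior_subset hs).2.trans hz.2⟩)
        (Or.inr rfl)).hasDerivWithinAt)
      (fun s hs => (hV s (by rwa [interior_Ioc] at hs)).le)
      ⟨mul_pos hν0 ht₁.1, h1⟩ ⟨hz.1, le_rfl⟩ h1
  have hUp := jacobiU_pos ht₁'.2 hU t₁ ⟨ht₁.1, le_rfl⟩
  rw [← sonin_comparator_pi_div_two (φ := jacobiPhi (2 * k + a) (a * (1 - a)) 0)]
  refine sonin_comparison (isOscillator_jacobi ha ha1 hb.le hb1.le n hsub
      fun s hs => (hnegs s ⟨ht₁.1.trans_le hs.1, hs.2⟩).le)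
    (isOscillator_comparator ha ha1 k hsub') ht₁.2 hz.2
    (fun s hs => hnegs s ⟨ht₁.1.trans_le hs.1, hs.2⟩)
    (fun s hs => jacobiPhi₁_comparator_neg hA ⟨hz.1.trans_le hs.1, hs.2⟩)
    jacobiPhi₁_comparator_pi_div_two hUp hU₁ (hVp z ⟨hz.1, le_rfl⟩) hVz
    (critical_slowness_le ha ha1 hb hb1 hk1 ht₁' (hnegs t₁ ht₁) hU₁ hU hz hVz hV hle)
    (fun s hs y hy heq => ?_) (by positivity) ?_
  · have hs0 : 0 < s := ht₁.1.trans_le hs.1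
    refine jacobiPhi_crossing hM.ne' hm hA hB (hsub hs) ⟨hz.1.trans_le hy.1, hy.2⟩
      (hnegs s ⟨hs0, hs.2⟩) (lt_of_le_of_lt ?_ hkq) heq
    have h3 := hcos s ⟨hs0, hs.2⟩
    have h4 : a * (1 - a) / Real.sin s ^ 2 ≤ a * (1 - a) / Real.sin t₁ ^ 2 := by
      have h5 := sin_pos_of_mem_Ioo ht₁'
      have h6 := Real.sin_le_sin_of_le_of_le_pi_div_two (by linarith [Real.pi_pos, ht₁.1])
        (hsub hs).2.le hs.1
      gcongr
    have h7 : 0 < jacobiPhi (2 * n + a + b) (a * (1 - a)) (b * (1 - b)) s :=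
      jacobiPhi_pos hM.ne' hA.le hB.le
    gcongr
    unfold jacobiPhi
    linarith
  · rw [← mul_pow]
    have := h2.trans (mul_le_mul_of_nonneg_left hVmono (by positivity : 0 ≤ ν⁻¹ ^ a))
    gcongr

theorem eventually_sonin_le (ha : 0 < a) (ha1 : a < 1) (hb : 0 < b) (hb1 : b < 1) (n : ℕ) {t : ℝ}
    (ht : t ∈ Ioo 0 (Real.pi / 2)) (hneg : jacobiPhi₁ (a * (1 - a)) (b * (1 - b)) t < 0) :
    ∀ᶠ k : ℕ in atTop,
      sonin (jacobiPhi (2 * n + a + b) (a * (1 - a)) (b * (1 - b))) (jacobiU a b n)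
        (jacobiU₁ a b n) t ≤
      (((2 * k + a) / (2 * n + a + b)) ^ a) ^ 2 * (jacobiPoly a 0 k).eval 1 ^ 2 := by
  have hB : 0 < b * (1 - b) := mul_pos hb (by linarith)
  have hlim : Tendsto (fun k : ℕ => 2 * (k : ℝ) + a) atTop atTop :=
    tendsto_atTop_add_const_right _ _ (tendsto_natCast_atTop_atTop.const_mul_atTop two_pos)
  by_cases hex : ∃ s ∈ Ioc 0 t, jacobiU₁ a b n s ≤ 0
  · obtain ⟨s, hs, hsU⟩ := hex
    have hc : ContinuousOn (jacobiU₁ a b n) (Ioc 0 s) := fun x hx =>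
      (hasDerivAt_jacobiU₁ n ha.le (sin_pos_of_mem_Ioo ⟨hx.1, (hx.2.trans hs.2).trans_lt ht.2⟩)
        (Or.inl (cos_pos_of_mem_Ioo
          ⟨hx.1, (hx.2.trans hs.2).trans_lt ht.2⟩))).continuousAt.continuousWithinAt
    obtain ⟨t₁, ht₁, hU₁, hU⟩ := exists_first_zero hs.1 hc (eventually_jacobiU₁_pos ha n) hsU
    have hlim2 := (tendsto_pow_atTop (α := ℝ) two_ne_zero).comp hlim
    have hlim4 := ((tendsto_pow_atTop (α := ℝ) (n := 4) (by norm_num)).comp hlim).const_mul_atTop hB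
    filter_upwards [eventually_ge_atTop 1, hlim.eventually_ge_atTop (2 * n + a + b),
      hlim2.eventually_ge_atTop _, hlim4.eventually_gt_atTop _] with k h1 h2 h3 h4
    exact sonin_le_of_critical ha ha1 hb hb1 h1 h2 ht hneg ⟨ht₁.1, ht₁.2.trans hs.2⟩ hU₁ hU h3 h4
  · push Not at hex
    filter_upwards [hlim.eventually_ge_atTop (2 * n + a + b)] with k hk
    exact sonin_le_of_noncritical ha ha1 hb.le hb1.le hk ht hex

end

theorem sum_neg_one_pow_mul_choose_succ (g : ℕ → ℝ) (k : ℕ) :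
    ∑ j ∈ Finset.range (k + 2), (-1) ^ j * ((k + 1).choose j : ℝ) * g j =
      ∑ j ∈ Finset.range (k + 1), (-1) ^ j * (k.choose j : ℝ) * g j -
        ∑ j ∈ Finset.range (k + 1), (-1) ^ j * (k.choose j : ℝ) * g (j + 1) := by
  have h : ∑ j ∈ Finset.range (k + 1), (-1) ^ j * (k.choose j : ℝ) * g j =
      ∑ j ∈ Finset.range (k + 2), (-1) ^ j * (k.choose j : ℝ) * g j := by
    rw [Finset.sum_range_succ _ (k + 1)]
    simp
  rw [h, Finset.sum_range_succ' _ (k + 1), Finset.sum_range_succ' _ (k + 1),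
    add_sub_right_comm, ← Finset.sum_sub_distrib]
  congr 1
  · refine Finset.sum_congr rfl fun j _ => ?_
    rw [Nat.choose_succ_succ]
    push_cast
    ring
  · simp

/-- The Chu–Vandermonde identity. -/
theorem sum_choose_mul_prod_div (k : ℕ) : ∀ p q : ℝ, 0 < q →
    ∑ j ∈ Finset.range (k + 1), (-1) ^ j * (k.choose j : ℝ) *
      ∏ i ∈ Finset.range j, (p + i) / (q + i) = ∏ i ∈ Finset.range k, (q - p + i) / (q + i) := by
  induction k with
  | zero => intro p q _; simp
  | succ k ih =>
    intro p q hq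
    have hshift : ∀ p' q' : ℝ, ∀ j : ℕ, ∏ i ∈ Finset.range (j + 1), (p' + i) / (q' + i) =
        p' / q' * ∏ i ∈ Finset.range j, (p' + 1 + i) / (q' + 1 + i) := by
      intro p' q' j
      rw [Finset.prod_range_succ', mul_comm]
      simp only [Nat.cast_zero, add_zero, Nat.cast_add, Nat.cast_one]
      congr 1
      exact Finset.prod_congr rfl fun i _ => by congr 1 <;> ring
    rw [sum_neg_one_pow_mul_choose_succ, ih p q hq]
    have h1 : ∑ j ∈ Finset.range (k + 1), (-1) ^ j * (k.choose j : ℝ) *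
        ∏ i ∈ Finset.range (j + 1), (p + i) / (q + i) =
        p / q * ∏ i ∈ Finset.range k, (q - p + i) / (q + 1 + i) := by
      rw [← (by ring : q + 1 - (p + 1) = q - p), ← ih (p + 1) (q + 1) (by linarith), Finset.mul_sum]
      exact Finset.sum_congr rfl fun j _ => by rw [hshift]; ring
    rw [h1]
    have h2 : ∏ i ∈ Finset.range k, (q - p + i) / (q + 1 + i) =
        q / (q + k) * ∏ i ∈ Finset.range k, (q - p + i) / (q + i) := by
      clear ih h1
      induction k with
      | zero => simp [hq.ne']
      | succ k ih =>
        rw [Finset.prod_range_succ, Finset.prod_range_succ, ih]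
        have h3 : q + k ≠ 0 := by positivity
        have h4 : q + k + 1 ≠ 0 := by positivity
        have h5 : q + 1 + k ≠ 0 := by positivity
        push_cast
        rw [← add_assoc]
        field_simp
        ring
    rw [h2, Finset.prod_range_succ]
    have h3 : q + k ≠ 0 := by positivity
    field_simp
    ring

theorem jacobiCoeff_eq {a : ℝ} (ha : 0 ≤ a) (b : ℝ) (n j : ℕ) :
    jacobiCoeff a b n j = (-1) ^ j * (n.choose j : ℝ) *
      ∏ i ∈ Finset.range j, (n + a + b + i) / (a + 1 / 2 + i) := by
  induction j with
  | zero => simp [jacobiCoeff]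
  | succ j ih =>
    have h1 : (n.choose (j + 1) : ℝ) * (j + 1) = n.choose j * (n - j) := by
      rcases le_or_gt j n with h | h
      · have := Nat.choose_succ_right_eq n j
        rw [← Nat.cast_sub h]
        exact_mod_cast this
      · rw [Nat.choose_eq_zero_of_lt h, Nat.choose_eq_zero_of_lt (h.trans j.lt_succ_self)]
        simp
    have h2 : (n.choose (j + 1) : ℝ) = n.choose j * (n - j) / (j + 1) := by
      rw [← h1]
      field_simp
    rw [jacobiCoeff, ih, Finset.prod_range_succ, h2]
    have : (j : ℝ) + a + 1 / 2 ≠ 0 := by positivity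
    have : a + 1 / 2 + (j : ℝ) ≠ 0 := by positivity
    field_simp
    ring

theorem prod_add_natCast_eq_Gamma_div {x : ℝ} (hx : 0 < x) (k : ℕ) :
    ∏ i ∈ Finset.range k, (x + i) = Real.Gamma (x + k) / Real.Gamma x := by
  have hg := (Real.Gamma_pos_of_pos hx).ne'
  induction k with
  | zero => simp [hg]
  | succ k ih =>
    rw [Finset.prod_range_succ, ih]
    push_cast
    rw [← add_assoc, Real.Gamma_add_one (by positivity)]
    field_simp

theorem jacobiPoly_eval_one {a : ℝ} (ha : 0 ≤ a) (b : ℝ) (n : ℕ) :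
    (jacobiPoly a b n).eval 1 =
      ∏ i ∈ Finset.range n, (1 / 2 - n - b + i) / (a + 1 / 2 + i) := by
  have := sum_choose_mul_prod_div n (n + a + b) (a + 1 / 2) (by positivity)
  rw [(by ring : a + 1 / 2 - (n + a + b) = 1 / 2 - n - b)] at this
  rw [← this]
  simp [jacobiPoly, Polynomial.eval_finsetSum, jacobiCoeff_eq ha]

theorem abs_comparator_eval_one {a : ℝ} (ha : 0 ≤ a) (k : ℕ) :
    |(jacobiPoly a 0 k).eval 1| =
      Real.Gamma (a + 1 / 2) / √Real.pi * (Real.Gamma (k + 1 / 2) / Real.Gamma (k + 1 / 2 + a)) := by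
  have hg := (Real.Gamma_pos_of_pos (by positivity : 0 < a + 1 / 2)).ne'
  rw [jacobiPoly_eval_one ha, Finset.abs_prod]
  have h1 : ∀ i ∈ Finset.range k, |(1 / 2 - k - 0 + i) / (a + 1 / 2 + i)| =
      (k - i - 1 / 2) / (a + 1 / 2 + i) := by
    intro i hi
    have h2 : (i : ℝ) + 1 ≤ k := by exact_mod_cast Finset.mem_range.1 hi
    rw [abs_div, abs_of_pos (by positivity : 0 < a + 1 / 2 + i), abs_of_nonpos (by linarith)]
    congr 1
    ring
  rw [Finset.prod_congr rfl h1, Finset.prod_div_distrib, ← Finset.prod_range_reflect]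
  have h2 : ∀ i ∈ Finset.range k, ((k : ℝ) - ((k - 1 - i : ℕ) : ℝ) - 1 / 2) = 1 / 2 + i := by
    intro i hi
    have h3 : k - 1 - i = k - (i + 1) := by omega
    rw [h3, Nat.cast_sub (Finset.mem_range.1 hi)]
    push_cast
    ring
  rw [Finset.prod_congr rfl h2, prod_add_natCast_eq_Gamma_div (by norm_num),
    prod_add_natCast_eq_Gamma_div (by positivity), Real.Gamma_one_half_eq,
    (by ring : (1 / 2 : ℝ) + k = k + 1 / 2), (by ring : a + 1 / 2 + (k : ℝ) = k + 1 / 2 + a)]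
  field_simp

theorem leadingCoeff_jacobi {a b : ℝ} (ha : 0 ≤ a) (hb : 0 ≤ b) {n : ℕ} (hn : 1 ≤ n) :
    jacobiCoeff a b n n = (-1) ^ n *
      (Real.Gamma (2 * n + a + b) / Real.Gamma (n + a + b) *
        (Real.Gamma (a + 1 / 2) / Real.Gamma (n + a + 1 / 2))) := by
  have hn' : (0 : ℝ) < n := by exact_mod_cast hn
  rw [jacobiCoeff_eq ha, Finset.prod_div_distrib, prod_add_natCast_eq_Gamma_div (by positivity),
    prod_add_natCast_eq_Gamma_div (by positivity), Nat.choose_self,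
    (by ring : (n : ℝ) + a + b + n = 2 * n + a + b),
    (by ring : a + 1 / 2 + (n : ℝ) = n + a + 1 / 2), div_div_eq_mul_div]
  push_cast
  ring

theorem Gamma_div_Gamma_add_le {x a : ℝ} (hx : 0 < x) (ha : 0 < a) (ha1 : a < 1) :
    Real.Gamma x / Real.Gamma (x + a) ≤ (x + a) ^ (1 - a) / x := by
  have hxa : 0 < x + a := by linarith
  have hg := Real.Gamma_pos_of_pos hxa
  have h := Real.Gamma_mul_add_mul_le_rpow_Gamma_mul_rpow_Gamma hxa
    (by linarith : 0 < x + a + 1) ha (by linarith : 0 < 1 - a) (by ring)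
  rw [Real.Gamma_add_one hxa.ne', (by ring : a * (x + a) + (1 - a) * (x + a + 1) = x + 1),
    Real.Gamma_add_one hx.ne', Real.mul_rpow hxa.le hg.le] at h
  rw [div_le_div_iff₀ hg hx]
  have h2 : Real.Gamma (x + a) ^ a * Real.Gamma (x + a) ^ (1 - a) = Real.Gamma (x + a) := by
    rw [← Real.rpow_add hg]
    simp
  calc _ = x * Real.Gamma x := mul_comm _ _
    _ ≤ _ := h
    _ = (x + a) ^ (1 - a) * (Real.Gamma (x + a) ^ a * Real.Gamma (x + a) ^ (1 - a)) := by ring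
    _ = _ := by rw [h2]

theorem comparator_amplitude_le {a M : ℝ} (ha : 0 < a) (ha1 : a < 1) (hM : 0 < M) (k : ℕ) :
    ((2 * k + a) / M) ^ a * |(jacobiPoly a 0 k).eval 1| ≤
      Real.Gamma (a + 1 / 2) / (√Real.pi * (M / 2) ^ a) * (1 + a / (k + 1 / 2)) ^ (1 - a) := by
  have hx : (0 : ℝ) < k + 1 / 2 := by positivity
  have hg := Real.Gamma_pos_of_pos (by positivity : 0 < a + 1 / 2)
  have h1 := Gamma_div_Gamma_add_le hx ha ha1
  rw [abs_comparator_eval_one ha.le]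
  have h2 : ((2 * k + a) / M) ^ a ≤ ((k + 1 / 2) / (M / 2)) ^ a := by
    refine Real.rpow_le_rpow (by positivity) ?_ ha.le
    rw [div_le_div_iff₀ (by positivity) (by positivity)]
    nlinarith
  have h3 : (k + 1 / 2 + a) ^ (1 - a) =
      (k + 1 / 2 : ℝ) ^ (1 - a) * (1 + a / (k + 1 / 2)) ^ (1 - a) := by
    rw [← Real.mul_rpow hx.le (by positivity)]
    congr 1
    field_simp
  have h4 : (k + 1 / 2 : ℝ) ^ a * (k + 1 / 2 : ℝ) ^ (1 - a) = k + 1 / 2 := by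
    rw [← Real.rpow_add hx]
    simp
  calc _ ≤ ((k + 1 / 2) / (M / 2)) ^ a * (Real.Gamma (a + 1 / 2) / √Real.pi *
        ((k + 1 / 2 + a) ^ (1 - a) / (k + 1 / 2))) := by gcongr
    _ = Real.Gamma (a + 1 / 2) / (√Real.pi * (M / 2) ^ a) *
        ((k + 1 / 2 : ℝ) ^ a * (k + 1 / 2 : ℝ) ^ (1 - a) / (k + 1 / 2)) *
        (1 + a / (k + 1 / 2)) ^ (1 - a) := by
      rw [h3, Real.div_rpow hx.le (by positivity)]
      field_simp
    _ = _ := by rw [h4, div_self hx.ne', mul_one]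

section
variable {a b : ℝ} {n : ℕ}

theorem sonin_le_of_phi₁_neg (ha : 0 < a) (ha1 : a < 1) (hb : 0 < b) (hb1 : b < 1) (n : ℕ) {t : ℝ}
    (ht : t ∈ Ioo 0 (Real.pi / 2)) (hneg : jacobiPhi₁ (a * (1 - a)) (b * (1 - b)) t < 0) :
    sonin (jacobiPhi (2 * n + a + b) (a * (1 - a)) (b * (1 - b))) (jacobiU a b n)
        (jacobiU₁ a b n) t ≤
      (Real.Gamma (a + 1 / 2) / (√Real.pi * ((2 * n + a + b) / 2) ^ a)) ^ 2 := by
  have hM : 0 < 2 * n + a + b := by positivity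
  have hlim : Tendsto (fun k : ℕ => (Real.Gamma (a + 1 / 2) /
      (√Real.pi * ((2 * n + a + b) / 2) ^ a) * (1 + a / ((k : ℝ) + 1 / 2)) ^ (1 - a)) ^ 2) atTop
      (𝓝 ((Real.Gamma (a + 1 / 2) / (√Real.pi * ((2 * n + a + b) / 2) ^ a) *
        (1 + 0) ^ (1 - a)) ^ 2)) := by
    have h1 : Tendsto (fun k : ℕ => (k : ℝ) + 1 / 2) atTop atTop :=
      tendsto_atTop_add_const_right _ _ tendsto_natCast_atTop_atTop
    exact ((((h1.const_div_atTop a).const_add 1).rpow_const (Or.inl (by norm_num))).const_mul _).pow 2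
  rw [add_zero, Real.one_rpow, mul_one] at hlim
  refine ge_of_tendsto hlim ?_
  filter_upwards [eventually_sonin_le ha ha1 hb hb1 n ht hneg] with k hk
  refine hk.trans ?_
  rw [← sq_abs (Polynomial.eval _ _), ← mul_pow]
  have := comparator_amplitude_le ha ha1 hM k
  gcongr

theorem exists_balance_point {A B : ℝ} (hA : 0 < A) (hB : 0 < B) :
    ∃ t ∈ Ioo 0 (Real.pi / 2), A * Real.cos t ^ 4 = B * Real.sin t ^ 4 := by
  have hc : ContinuousOn (fun t => B * Real.sin t ^ 4 - A * Real.cos t ^ 4)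
      (Icc 0 (Real.pi / 2)) := by fun_prop
  obtain ⟨t, ht, h⟩ := intermediate_value_Ioo (by positivity) hc
    (show (0 : ℝ) ∈ _ by simp [hA, hB])
  exact ⟨t, ht, by simp only at h; linarith⟩

theorem sonin_le (ha : 0 < a) (ha1 : a < 1) (hb : 0 < b) (hb1 : b < 1) (n : ℕ) {t : ℝ}
    (ht : t ∈ Ioo 0 (Real.pi / 2)) :
    sonin (jacobiPhi (2 * n + a + b) (a * (1 - a)) (b * (1 - b))) (jacobiU a b n)
        (jacobiU₁ a b n) t ≤
      (Real.Gamma (a + 1 / 2) / (√Real.pi * ((2 * n + a + b) / 2) ^ a)) ^ 2 := by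
  have hA : 0 < a * (1 - a) := mul_pos ha (by linarith)
  have hB : 0 < b * (1 - b) := mul_pos hb (by linarith)
  have hM : 0 < 2 * n + a + b := by positivity
  set A := a * (1 - a) with hAdef
  set B := b * (1 - b) with hBdef
  have hd : ∀ s ∈ Ioo 0 (Real.pi / 2), HasDerivAt (sonin (jacobiPhi (2 * n + a + b) A B)
      (jacobiU a b n) (jacobiU₁ a b n))
      (-(jacobiPhi₁ A B s * jacobiU₁ a b n s ^ 2 / jacobiPhi (2 * n + a + b) A B s ^ 2)) s := by
    intro s hs
    have h1 := hasDerivAt_jacobiU (a := a) (b := b) n (sin_pos_of_mem_Ioo hs)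
      (Or.inl (cos_pos_of_mem_Ioo hs))
    have h2 := hasDerivAt_jacobiU₁ (a := a) (b := b) n ha.le (sin_pos_of_mem_Ioo hs)
      (Or.inl (cos_pos_of_mem_Ioo hs))
    have h3 := hasDerivAt_jacobiPhi (A := A) (B := B) (2 * n + a + b) (sin_pos_of_mem_Ioo hs)
      (Or.inl (cos_pos_of_mem_Ioo hs))
    have h4 : jacobiPhi (2 * n + a + b) A B s ≠ 0 := (jacobiPhi_pos hM.ne' hA.le hB.le).ne'
    refine ((h1.pow 2).add ((h2.pow 2).div h3 h4)).congr_deriv ?_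
    simp only [Pi.pow_apply, ← hAdef, ← hBdef]
    field_simp
    ring
  obtain ⟨τ, hτ, hbal⟩ := exists_balance_point hA hB
  have hcτ := cos_pos_of_mem_Ioo hτ
  have hsτ := sin_pos_of_mem_Ioo hτ
  have hneg : ∀ s ∈ Ioo 0 τ, jacobiPhi₁ A B s < 0 := by
    intro s hs
    have hs' : s ∈ Ioo 0 (Real.pi / 2) := ⟨hs.1, hs.2.trans hτ.2⟩
    have h1 := sin_pos_of_mem_Ioo hs'
    have h2 := cos_pos_of_mem_Ioo hs'
    rw [jacobiPhi₁_neg_iff h1 h2]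
    have h3 : Real.sin s < Real.sin τ :=
      Real.sin_lt_sin_of_lt_of_le_pi_div_two (by linarith [hs.1, Real.pi_pos]) hτ.2.le hs.2
    have h4 : Real.cos τ ≤ Real.cos s :=
      Real.cos_le_cos_of_nonneg_of_le_pi hs.1.le (by linarith [hτ.2, Real.pi_pos]) hs.2.le
    calc B * Real.sin s ^ 4 < B * Real.sin τ ^ 4 := by gcongr
      _ = A * Real.cos τ ^ 4 := hbal.symm
      _ ≤ _ := by gcongr
  have hτle : sonin (jacobiPhi (2 * n + a + b) A B) (jacobiU a b n) (jacobiU₁ a b n) τ ≤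
      (Real.Gamma (a + 1 / 2) / (√Real.pi * ((2 * n + a + b) / 2) ^ a)) ^ 2 := by
    have hlim := (hd τ hτ).continuousAt.tendsto.mono_left (nhdsWithin_le_nhds (s := Iio τ))
    refine le_of_tendsto hlim ?_
    filter_upwards [Ioo_mem_nhdsLT hτ.1] with s hs
    exact sonin_le_of_phi₁_neg ha ha1 hb hb1 n ⟨hs.1, hs.2.trans hτ.2⟩ (hneg s hs)
  rcases lt_or_ge t τ with h | h
  · exact sonin_le_of_phi₁_neg ha ha1 hb hb1 n ht (hneg t ⟨ht.1, h⟩)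
  refine le_trans ?_ hτle
  have hmem : ∀ s ∈ Icc τ t, s ∈ Ioo 0 (Real.pi / 2) := fun s hs =>
    ⟨hτ.1.trans_le hs.1, hs.2.trans_lt ht.2⟩
  refine antitoneOn_of_hasDerivWithinAt_nonpos (convex_Icc τ t)
    (fun s hs => (hd s (hmem s hs)).continuousAt.continuousWithinAt)
    (fun s hs => (hd s (hmem s (interior_subset hs))).hasDerivWithinAt) (fun s hs => ?_)
    ⟨le_rfl, h⟩ ⟨h, le_rfl⟩ h
  have hs' := interior_subset hs
  have h1 := sin_pos_of_mem_Ioo (hmem s hs')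
  have h2 := cos_pos_of_mem_Ioo (hmem s hs')
  have h3 : 0 ≤ jacobiPhi₁ A B s := by
    rw [jacobiPhi₁_nonneg_iff h1 h2]
    have h4 : Real.sin τ ≤ Real.sin s :=
      Real.sin_le_sin_of_le_of_le_pi_div_two (by linarith [hτ.1, Real.pi_pos])
        (hmem s hs').2.le hs'.1
    have h5 : Real.cos s ≤ Real.cos τ :=
      Real.cos_le_cos_of_nonneg_of_le_pi hτ.1.le (by linarith [(hmem s hs').2, Real.pi_pos]) hs'.1
    calc A * Real.cos s ^ 4 ≤ A * Real.cos τ ^ 4 := by gcongr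
      _ = B * Real.sin τ ^ 4 := hbal
      _ ≤ _ := by gcongr
  rw [neg_nonpos]
  positivity

theorem abs_jacobiU_le_of_mem_Ioo (ha : 0 < a) (ha1 : a < 1) (hb : 0 < b) (hb1 : b < 1) (n : ℕ)
    {t : ℝ} (ht : t ∈ Ioo 0 (Real.pi / 2)) :
    |jacobiU a b n t| ≤ Real.Gamma (a + 1 / 2) / (√Real.pi * ((2 * n + a + b) / 2) ^ a) := by
  have hg := Real.Gamma_pos_of_pos (by positivity : 0 < a + 1 / 2)
  refine abs_le_of_sq_le_sq ?_ (by positivity)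
  refine le_trans ?_ (sonin_le ha ha1 hb hb1 n ht)
  have h1 : 0 < jacobiPhi (2 * n + a + b) (a * (1 - a)) (b * (1 - b)) t :=
    jacobiPhi_pos (by positivity) (mul_nonneg ha.le (by linarith)) (mul_nonneg hb.le (by linarith))
  unfold sonin
  exact le_add_of_nonneg_right (by positivity)

end

theorem tendsto_jacobiCoeff {ι : Type*} {l : Filter ι} {f g : ι → ℝ} {a b : ℝ} (ha : 0 ≤ a)
    (hf : Tendsto f l (𝓝 a)) (hg : Tendsto g l (𝓝 b)) (n k : ℕ) :
    Tendsto (fun i => jacobiCoeff (f i) (g i) n k) l (𝓝 (jacobiCoeff a b n k)) := by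
  induction k with
  | zero => exact tendsto_const_nhds
  | succ k ih =>
    simp only [jacobiCoeff]
    refine Tendsto.mul (Tendsto.div ?_ ?_ (by positivity)) ih
    · exact (((hf.const_add _).add hg).const_mul _)
    · exact (((hf.const_add _).add_const _).const_mul _)

section
variable {a b : ℝ} {n : ℕ}

theorem tendsto_jacobiU {ι : Type*} {l : Filter ι} {f g : ι → ℝ} (ha : 0 ≤ a)
    (hf : Tendsto f l (𝓝 a)) (hg : Tendsto g l (𝓝 b)) (n : ℕ) {t : ℝ}
    (ht : t ∈ Ioo 0 (Real.pi / 2)) :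
    Tendsto (fun i => jacobiU (f i) (g i) n t) l (𝓝 (jacobiU a b n t)) := by
  simp only [jacobiU, jacobiPoly, Polynomial.eval_finsetSum, Polynomial.eval_monomial]
  refine ((tendsto_const_nhds.rpow hf (Or.inl (sin_pos_of_mem_Ioo ht).ne')).mul
    (tendsto_const_nhds.rpow hg (Or.inl (cos_pos_of_mem_Ioo ht).ne'))).mul ?_
  exact tendsto_finsetSum _ fun k _ => (tendsto_jacobiCoeff ha hf hg n k).mul_const _

/-- The uniform bound for the weighted Jacobi polynomials. -/
theorem abs_jacobiU_le (ha : a ∈ Icc 0 1) (hb : b ∈ Icc 0 1) (hn : 1 ≤ n) {t : ℝ}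
    (ht : t ∈ Ioo 0 (Real.pi / 2)) :
    |jacobiU a b n t| ≤ Real.Gamma (a + 1 / 2) / (√Real.pi * ((2 * n + a + b) / 2) ^ a) := by
  have hn' : (0 : ℝ) < n := by exact_mod_cast hn
  have ha0 := ha.1
  have hb0 := hb.1
  have hpath : ∀ c : ℝ, Tendsto (fun ε : ℝ => c + ε * (1 / 2 - c)) (𝓝[>] 0) (𝓝 c) := fun c =>
    Continuous.tendsto_nhdsGT_zero (by fun_prop) (by simp)
  have hL : Tendsto (fun ε : ℝ => Real.Gamma (a + ε * (1 / 2 - a) + 1 / 2) /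
      (√Real.pi * ((2 * n + (a + ε * (1 / 2 - a)) + (b + ε * (1 / 2 - b))) / 2) ^
        (a + ε * (1 / 2 - a)))) (𝓝[>] 0)
      (𝓝 (Real.Gamma (a + 1 / 2) / (√Real.pi * ((2 * n + a + b) / 2) ^ a))) := by
    have hG : ContinuousAt Real.Gamma (a + 1 / 2) :=
      (Real.differentiableAt_Gamma fun m => by
        have : (0 : ℝ) ≤ m := m.cast_nonneg
        linarith).continuousAt
    have hN : 0 < (2 * n + a + b) / 2 := by positivity
    refine (hG.tendsto.comp ((hpath a).add_const _)).div (Tendsto.const_mul _ ?_) (by positivity)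
    exact ((((hpath a).const_add _).add (hpath b)).div_const _).rpow (hpath a) (Or.inl hN.ne')
  refine le_of_tendsto_of_tendsto (tendsto_jacobiU ha.1 (hpath a) (hpath b) n ht).abs hL ?_
  filter_upwards [eventually_nhdsGT_zero_mem_Ioo one_pos] with ε hε
  have hin : ∀ c ∈ Icc (0 : ℝ) 1, 0 < c + ε * (1 / 2 - c) ∧ c + ε * (1 / 2 - c) < 1 :=
    fun c hc => ⟨by nlinarith [hc.1, hc.2, hε.1, hε.2], by nlinarith [hc.1, hc.2, hε.1, hε.2]⟩
  exact abs_jacobiU_le_of_mem_Ioo (hin a ha).1 (hin a ha).2 (hin b hb).1 (hin b hb).2 n ht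

theorem rpow_mul_abs_jacobiPoly_le {α β : ℝ} (hα : α ∈ Icc (0 : ℝ) (1 / 2))
    (hβ : β ∈ Icc (0 : ℝ) (1 / 2)) (hn : 1 ≤ n) {y : ℝ} (hy : y ∈ Ioo (-1 : ℝ) 1) :
    (1 - y) ^ α * (1 + y) ^ β * |(jacobiPoly (2 * α) (2 * β) n).eval ((1 - y) / 2)| ≤
      2 ^ (α + β) * (Real.Gamma (2 * α + 1 / 2) / (√Real.pi * (n + α + β) ^ (2 * α))) := by
  have ht : Real.arccos y / 2 ∈ Ioo 0 (Real.pi / 2) := by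
    have h1 : Real.arccos y < Real.pi := by
      have := Real.arccos_lt_arccos le_rfl hy.1 hy.2.le
      rwa [Real.arccos_neg_one] at this
    exact ⟨half_pos (Real.arccos_pos.2 hy.2), by linarith⟩
  have hs := sin_pos_of_mem_Ioo ht
  have hc := cos_pos_of_mem_Ioo ht
  have hcos : y = 2 * Real.cos (Real.arccos y / 2) ^ 2 - 1 := by
    rw [← Real.cos_two_mul, mul_div_cancel₀ _ two_ne_zero, Real.cos_arccos hy.1.le hy.2.le]
  have hsc := Real.sin_sq_add_cos_sq (Real.arccos y / 2)
  have h := abs_jacobiU_le (a := 2 * α) (b := 2 * β) ⟨by linarith [hα.1], by linarith [hα.2]⟩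
    ⟨by linarith [hβ.1], by linarith [hβ.2]⟩ hn ht
  obtain ⟨t, htdef⟩ : ∃ t, t = Real.arccos y / 2 := ⟨_, rfl⟩
  rw [← htdef] at h hs hc hcos hsc
  have h1 : 1 - y = 2 * Real.sin t ^ 2 := by linarith
  have h2 : 1 + y = 2 * Real.cos t ^ 2 := by linarith
  have h3 : (2 * n + 2 * α + 2 * β) / 2 = n + α + β := by ring
  have hsq : ∀ x : ℝ, 0 < x → ∀ p : ℝ, (2 * x ^ 2) ^ p = 2 ^ p * x ^ (2 * p) := by
    intro x hx p
    rw [Real.mul_rpow two_pos.le (by positivity), ← Real.rpow_natCast, ← Real.rpow_mul hx.le]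
    norm_num
  rw [h1, h2, hsq _ hs, hsq _ hc, mul_div_cancel_left₀ _ (two_ne_zero), Real.rpow_add two_pos, ← h3]
  rw [jacobiU, abs_mul, abs_of_pos (by positivity)] at h
  calc _ = 2 ^ α * 2 ^ β * (Real.sin t ^ (2 * α) * Real.cos t ^ (2 * β) *
        |(jacobiPoly (2 * α) (2 * β) n).eval (Real.sin t ^ 2)|) := by ring
    _ ≤ _ := by gcongr

end

theorem jacobiSup_nonneg (ρa ρb : ℝ) (P : Polynomial ℝ) : 0 ≤ jacobiSup ρa ρb P := by
  refine Real.sSup_nonneg ?_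
  rintro _ ⟨x, hx, rfl⟩
  have h1 : 0 ≤ 1 - x := by linarith [hx.2]
  have h2 : 0 ≤ 1 + x := by linarith [hx.1]
  positivity

theorem widomFactor_le_of_forall_Ioo {ρa ρb K : ℝ} (ha : 0 ≤ ρa) (hb : 0 ≤ ρb) {P : Polynomial ℝ}
    {n : ℕ} (hP : P.natDegree = n) (hlead : P.coeff n ≠ 0)
    (hK : ∀ y ∈ Ioo (-1 : ℝ) 1, (1 - y) ^ ρa * (1 + y) ^ ρb * |P.eval y| ≤ K) :
    widomFactor ρa ρb n ≤ 2 ^ n * (K / |P.coeff n|) := by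
  have hlc : P.leadingCoeff = P.coeff n := by rw [Polynomial.leadingCoeff, hP]
  have hP0 : P ≠ 0 := by rintro rfl; simp at hlead
  have hcont : Continuous fun y : ℝ => (1 - y) ^ ρa * (1 + y) ^ ρb * |P.eval y| :=
    (((continuous_const.sub continuous_id).rpow_const fun _ => Or.inr ha).mul
      ((continuous_const.add continuous_id).rpow_const fun _ => Or.inr hb)).mul P.continuous.abs
  have hK' : ∀ y ∈ Icc (-1 : ℝ) 1, (1 - y) ^ ρa * (1 + y) ^ ρb * |P.eval y| ≤ K := by
    rw [← closure_Ioo (by norm_num : (-1 : ℝ) ≠ 1)]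
    exact closure_minimal hK (isClosed_le hcont continuous_const)
  unfold widomFactor
  refine mul_le_mul_of_nonneg_left ?_ (by positivity)
  have hbdd : BddBelow (jacobiSup ρa ρb '' {P : Polynomial ℝ | P.Monic ∧ P.natDegree = n}) := by
    refine ⟨0, ?_⟩
    rintro _ ⟨Q, -, rfl⟩
    exact jacobiSup_nonneg _ _ _
  refine (csInf_le hbdd ⟨P * Polynomial.C P.leadingCoeff⁻¹,
    ⟨Polynomial.monic_mul_leadingCoeff_inv hP0, ?_⟩, rfl⟩).trans ?_
  · rw [Polynomial.natDegree_mul_leadingCoeff_inv _ hP0, hP]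
  · refine csSup_le ⟨_, ⟨0, by norm_num, rfl⟩⟩ ?_
    rintro _ ⟨y, hy, rfl⟩
    simp only [Polynomial.eval_mul, Polynomial.eval_C, abs_mul, abs_inv, hlc]
    rw [← mul_assoc, ← div_eq_mul_inv]
    exact div_le_div_of_nonneg_right (hK' y hy) (abs_nonneg _)

theorem natDegree_jacobiPoly {a b : ℝ} {n : ℕ} (h : jacobiCoeff a b n n ≠ 0) :
    (jacobiPoly a b n).natDegree = n := by
  refine Polynomial.natDegree_eq_of_le_of_coeff_ne_zero ?_ (by rwa [coeff_jacobiPoly])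
  exact Polynomial.natDegree_sum_le_of_forall_le _ _ fun k hk =>
    (Polynomial.natDegree_monomial_le _).trans (Nat.lt_succ_iff.1 (Finset.mem_range.1 hk))

theorem natDegree_comp_affine_coeff {P : Polynomial ℝ} {n : ℕ} (hP : P.natDegree = n) {c : ℝ}
    (hc : c ≠ 0) (d : ℝ) :
    (P.comp (Polynomial.C c * Polynomial.X + Polynomial.C d)).natDegree = n ∧
      (P.comp (Polynomial.C c * Polynomial.X + Polynomial.C d)).coeff n = P.coeff n * c ^ n := by
  have hdeg := Polynomial.natDegree_linear (b := d) hc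
  have h : (P.comp (Polynomial.C c * Polynomial.X + Polynomial.C d)).natDegree = n := by
    rw [Polynomial.natDegree_comp, hdeg, hP, mul_one]
  refine ⟨h, ?_⟩
  have := Polynomial.leadingCoeff_comp (p := P) (by rw [hdeg]; exact one_ne_zero)
  rwa [Polynomial.leadingCoeff_linear hc, Polynomial.leadingCoeff, Polynomial.leadingCoeff, h,
    hP] at this

theorem widomFactor_le_of_jacobi_bound {ρa ρb α β c d : ℝ} (ha : 0 ≤ ρa) (hb : 0 ≤ ρb)
    (hα : α ∈ Icc (0 : ℝ) (1 / 2)) (hβ : β ∈ Icc (0 : ℝ) (1 / 2)) {n : ℕ} (hn : 1 ≤ n)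
    (hc : |c| = 1 / 2)
    (hK : ∀ y ∈ Ioo (-1 : ℝ) 1, (1 - y) ^ ρa * (1 + y) ^ ρb *
      |(jacobiPoly (2 * α) (2 * β) n).eval (c * y + d)| ≤
      2 ^ (α + β) * (Real.Gamma (2 * α + 1 / 2) / (√Real.pi * (n + α + β) ^ (2 * α)))) :
    widomFactor ρa ρb n ≤ 2 ^ (2 * (n : ℝ) + α + β) * Real.Gamma (n + 2 * α + 1 / 2) *
      Real.Gamma (n + 2 * α + 2 * β) /
        (√Real.pi * (n + α + β) ^ (2 * α) * Real.Gamma (2 * n + 2 * α + 2 * β)) := by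
  have hα0 := hα.1
  have hβ0 := hβ.1
  have hn' : (0 : ℝ) < n := by exact_mod_cast hn
  have g1 := Real.Gamma_pos_of_pos (by positivity : 0 < 2 * α + 1 / 2)
  have g2 := Real.Gamma_pos_of_pos (by positivity : 0 < n + 2 * α + 1 / 2)
  have g3 := Real.Gamma_pos_of_pos (by positivity : 0 < n + 2 * α + 2 * β)
  have g4 := Real.Gamma_pos_of_pos (by positivity : 0 < 2 * n + 2 * α + 2 * β)
  have hl := leadingCoeff_jacobi (a := 2 * α) (b := 2 * β) (by positivity) (by positivity) hn
  have hl0 : jacobiCoeff (2 * α) (2 * β) n n ≠ 0 := by rw [hl]; positivity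
  have hc0 : c ≠ 0 := by rintro rfl; norm_num at hc
  obtain ⟨h1, h2⟩ := natDegree_comp_affine_coeff (natDegree_jacobiPoly hl0) hc0 d
  refine (widomFactor_le_of_forall_Ioo ha hb h1
    (by rw [h2, coeff_jacobiPoly]; exact mul_ne_zero hl0 (pow_ne_zero _ hc0))
    (fun y hy => ?_)).trans_eq (b := 2 ^ n * (2 ^ (α + β) * (Real.Gamma (2 * α + 1 / 2) /
      (√Real.pi * (n + α + β) ^ (2 * α))) / _)) ?_
  · have := hK y hy
    simpa [Polynomial.eval_comp] using this
  · have hp : (2 : ℝ) ^ (2 * (n : ℝ) + α + β) = 2 ^ n * 2 ^ n * 2 ^ (α + β) := by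
      rw [← Real.rpow_natCast, ← Real.rpow_add two_pos, ← Real.rpow_add two_pos]
      congr 1
      ring
    have hN : 0 < ((n : ℝ) + α + β) ^ (2 * α) := by positivity
    rw [h2, coeff_jacobiPoly, hl, abs_mul, abs_mul, abs_pow, abs_neg, abs_one, one_pow, one_mul,
      abs_pow, hc, abs_of_pos (by positivity), hp, one_div, inv_pow]
    field_simp

theorem strictConvexOn_log_Gamma : StrictConvexOn ℝ (Ioi 0) (Real.log ∘ Real.Gamma) := by
  refine ⟨convex_Ioi 0, fun x hx y hy hxy p q hp hq hpq => ?_⟩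
  have hx0 : 0 < x := hx
  have hy0 : 0 < y := hy
  have hz0 : 0 < p * x + q * y := by positivity
  have hlog : ∀ z : ℝ, 0 < z → Real.log (Real.Gamma (z + 1)) =
      Real.log z + Real.log (Real.Gamma z) := fun z hz => by
    rw [Real.Gamma_add_one hz.ne', Real.log_mul hz.ne' (Real.Gamma_pos_of_pos hz).ne']
  have h1 := Real.convexOn_log_Gamma.2 (show x + 1 ∈ Ioi (0 : ℝ) from add_pos hx0 one_pos)
    (show y + 1 ∈ Ioi (0 : ℝ) from add_pos hy0 one_pos) hp.le hq.le hpq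
  have h2 := strictConcaveOn_log_Ioi.2 hx hy hxy hp hq hpq
  simp only [smul_eq_mul, Function.comp] at h1 h2 ⊢
  have h3 : p * (x + 1) + q * (y + 1) = p * x + q * y + 1 := by linear_combination hpq
  rw [h3, hlog _ hx0, hlog _ hy0, hlog _ hz0] at h1
  linarith

section
variable {N s d : ℝ}

theorem log_Gamma_add_three_le (hN : 0 < N) (hd : 0 ≤ d) (hds : d ≤ s) (hsd : s + d ≤ 1) :
    Real.log (Real.Gamma (N + s)) ≤ (1 - s - d) * Real.log (Real.Gamma N) +
      (s - d) * Real.log (Real.Gamma (N + 1)) + 2 * d * Real.log (Real.Gamma (N + 1 / 2)) := by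
  have h := Real.convexOn_log_Gamma.map_sum_le (t := Finset.univ)
    (w := ![1 - s - d, s - d, 2 * d]) (p := ![N, N + 1, N + 1 / 2])
    (by
      intro i _
      fin_cases i
      · show (0 : ℝ) ≤ 1 - s - d
        linarith
      · show (0 : ℝ) ≤ s - d
        linarith
      · show (0 : ℝ) ≤ 2 * d
        linarith)
    (by simp only [Fin.sum_univ_three, Matrix.cons_val]; ring)
    (by
      intro i _
      fin_cases i
      · exact hN
      · exact add_pos hN one_pos
      · exact add_pos hN (by norm_num))
  simp only [Fin.sum_univ_three, Matrix.cons_val, smul_eq_mul, Function.comp] at h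
  have h1 : (1 - s - d) * N + (s - d) * (N + 1) + 2 * d * (N + 1 / 2) = N + s := by ring
  rwa [h1] at h

theorem log_Gamma_mul_Gamma_identities (hN : 0 < N) (hd : 0 ≤ d) (hds : d ≤ s) :
    (Real.log (Real.Gamma (N + 1 / 2 + d) * Real.Gamma (N + s)) =
      Real.log (Real.Gamma (N + 1 / 2 + d)) + Real.log (Real.Gamma (N + s))) ∧
    (Real.log (Real.Gamma (N + 1 / 2) * Real.Gamma N * N ^ (s + d)) =
      Real.log (Real.Gamma (N + 1 / 2)) + Real.log (Real.Gamma N) + (s + d) * Real.log N) ∧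
    Real.log (Real.Gamma (N + 1)) = Real.log N + Real.log (Real.Gamma N) := by
  have g1 := (Real.Gamma_pos_of_pos (by linarith : 0 < N + 1 / 2 + d)).ne'
  have g2 := (Real.Gamma_pos_of_pos (by linarith : 0 < N + s)).ne'
  have g3 := (Real.Gamma_pos_of_pos (by linarith : 0 < N + 1 / 2)).ne'
  have g4 := (Real.Gamma_pos_of_pos hN).ne'
  refine ⟨Real.log_mul g1 g2, ?_, ?_⟩
  · rw [Real.log_mul (mul_ne_zero g3 g4) (by positivity), Real.log_mul g3 g4, Real.log_rpow hN]
  · rw [Real.Gamma_add_one hN.ne', Real.log_mul hN.ne' g4]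

theorem Gamma_mul_Gamma_le (hN : 0 < N) (hd : 0 ≤ d) (hds : d ≤ s) (hsd : s + d ≤ 1) :
    Real.Gamma (N + 1 / 2 + d) * Real.Gamma (N + s) ≤
      Real.Gamma (N + 1 / 2) * Real.Gamma N * N ^ (s + d) := by
  have g1 := Real.Gamma_pos_of_pos (by linarith : 0 < N + 1 / 2 + d)
  have g2 := Real.Gamma_pos_of_pos (by linarith : 0 < N + s)
  have g3 := Real.Gamma_pos_of_pos (by linarith : 0 < N + 1 / 2)
  have g4 := Real.Gamma_pos_of_pos hN
  obtain ⟨e1, e2, e3⟩ := log_Gamma_mul_Gamma_identities hN hd hds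
  rw [← Real.log_le_log_iff (by positivity) (by positivity), e1, e2]
  have h1 := log_Gamma_add_three_le hN hd hds hsd
  have h2 := Real.convexOn_log_Gamma.2 (show N + 1 / 2 ∈ Ioi (0 : ℝ) from add_pos hN (by norm_num))
    (show N + 1 ∈ Ioi (0 : ℝ) from add_pos hN one_pos) (by linarith : 0 ≤ 1 - 2 * d)
    (by linarith : 0 ≤ 2 * d) (by ring)
  simp only [smul_eq_mul, Function.comp] at h2
  rw [(by ring : (1 - 2 * d) * (N + 1 / 2) + 2 * d * (N + 1) = N + 1 / 2 + d), e3] at h2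
  rw [e3] at h1
  linarith

theorem Gamma_mul_Gamma_lt (hN : 0 < N) (hd : 0 ≤ d) (hds : d ≤ s) (hsd : s + d ≤ 1)
    (hne : d ≠ 1 / 2) (h0 : d = 0 → 0 < s ∧ s < 1) :
    Real.Gamma (N + 1 / 2 + d) * Real.Gamma (N + s) <
      Real.Gamma (N + 1 / 2) * Real.Gamma N * N ^ (s + d) := by
  have g1 := Real.Gamma_pos_of_pos (by linarith : 0 < N + 1 / 2 + d)
  have g2 := Real.Gamma_pos_of_pos (by linarith : 0 < N + s)
  have g3 := Real.Gamma_pos_of_pos (by linarith : 0 < N + 1 / 2)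
  have g4 := Real.Gamma_pos_of_pos hN
  obtain ⟨e1, e2, e3⟩ := log_Gamma_mul_Gamma_identities hN hd hds
  rw [← Real.log_lt_log_iff (by positivity) (by positivity), e1, e2]
  rcases eq_or_lt_of_le hd with rfl | hd'
  · have h2 := strictConvexOn_log_Gamma.2 (show N ∈ Ioi (0 : ℝ) from hN)
      (show N + 1 ∈ Ioi (0 : ℝ) from add_pos hN one_pos) (by simp)
      (by linarith [(h0 rfl).2] : 0 < 1 - s) (h0 rfl).1 (by ring)
    simp only [smul_eq_mul, Function.comp] at h2
    rw [(by ring : (1 - s) * N + s * (N + 1) = N + s), e3] at h2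
    simp only [add_zero]
    linarith
  · have hlt : d < 1 / 2 := lt_of_le_of_ne (by linarith) hne
    have h1 := log_Gamma_add_three_le hN hd hds hsd
    have h2 := strictConvexOn_log_Gamma.2
      (show N + 1 / 2 ∈ Ioi (0 : ℝ) from add_pos hN (by norm_num))
      (show N + 1 ∈ Ioi (0 : ℝ) from add_pos hN one_pos) (by norm_num)
      (by linarith : 0 < 1 - 2 * d) (by linarith : 0 < 2 * d) (by ring)
    simp only [smul_eq_mul, Function.comp] at h2
    rw [(by ring : (1 - 2 * d) * (N + 1 / 2) + 2 * d * (N + 1) = N + 1 / 2 + d), e3] at h2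
    rw [e3] at h1
    linarith

end

theorem gamma_bound_eq {α β : ℝ} (hα : 0 ≤ α) (hβ : 0 ≤ β) {n : ℕ} (hn : 1 ≤ n) :
    (2 : ℝ) ^ (2 * (n : ℝ) + α + β) * Real.Gamma (n + 2 * α + 1 / 2) *
      Real.Gamma (n + 2 * α + 2 * β) /
        (√Real.pi * (n + α + β) ^ (2 * α) * Real.Gamma (2 * n + 2 * α + 2 * β)) =
      2 ^ (1 - α - β) * (Real.Gamma (n + α + β + 1 / 2 + (α - β)) *
        Real.Gamma (n + α + β + (α + β)) / (Real.Gamma (n + α + β + 1 / 2) *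
          Real.Gamma (n + α + β) * (n + α + β) ^ (α + β + (α - β)))) := by
  have hn' : (0 : ℝ) < n := by exact_mod_cast hn
  have g1 := Real.Gamma_pos_of_pos (by positivity : 0 < n + α + β)
  have g2 := Real.Gamma_pos_of_pos (by positivity : 0 < n + α + β + 1 / 2)
  have g4 := Real.Gamma_pos_of_pos (by positivity : 0 < 2 * n + 2 * α + 2 * β)
  have hdup := Real.Gamma_mul_Gamma_add_half (n + α + β)
  rw [(by ring : 2 * (n + α + β) = 2 * n + 2 * α + 2 * β)] at hdup
  have hp : (2 : ℝ) ^ (2 * (n : ℝ) + α + β) * 2 ^ (1 - (2 * n + 2 * α + 2 * β)) =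
      2 ^ (1 - α - β) := by
    rw [← Real.rpow_add two_pos]
    congr 1
    ring
  have hN : 0 < ((n : ℝ) + α + β) ^ (2 * α) := by positivity
  rw [(by ring : (n : ℝ) + α + β + 1 / 2 + (α - β) = n + 2 * α + 1 / 2),
    (by ring : (n : ℝ) + α + β + (α + β) = n + 2 * α + 2 * β),
    (by ring : α + β + (α - β) = 2 * α), mul_comm (Real.Gamma (n + α + β + 1 / 2)), hdup, ← hp]
  field_simp

theorem gamma_bound_le {α β : ℝ} (hα : α ∈ Icc (0 : ℝ) (1 / 2)) (hβ : 0 ≤ β) (hβα : β ≤ α) {n : ℕ}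
    (hn : 1 ≤ n) :
    (2 : ℝ) ^ (2 * (n : ℝ) + α + β) * Real.Gamma (n + 2 * α + 1 / 2) *
      Real.Gamma (n + 2 * α + 2 * β) /
        (√Real.pi * (n + α + β) ^ (2 * α) * Real.Gamma (2 * n + 2 * α + 2 * β)) ≤
      2 ^ (1 - α - β) := by
  have hn' : (0 : ℝ) < n := by exact_mod_cast hn
  have hα0 := hα.1
  have hN : 0 < n + α + β := by positivity
  have g1 := Real.Gamma_pos_of_pos hN
  have g2 := Real.Gamma_pos_of_pos (by positivity : 0 < n + α + β + 1 / 2)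
  rw [gamma_bound_eq hα.1 hβ hn]
  refine mul_le_of_le_one_right (by positivity) ((div_le_one (by positivity)).2 ?_)
  exact Gamma_mul_Gamma_le hN (by linarith) (by linarith) (by linarith [hα.2])

theorem gamma_bound_lt {α β : ℝ} (hα : α ∈ Icc (0 : ℝ) (1 / 2)) (hβ : 0 ≤ β) (hβα : β ≤ α) {n : ℕ}
    (hn : 1 ≤ n) (hv : ¬ ((α = 0 ∨ α = 1 / 2) ∧ (β = 0 ∨ β = 1 / 2))) :
    (2 : ℝ) ^ (2 * (n : ℝ) + α + β) * Real.Gamma (n + 2 * α + 1 / 2) *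
      Real.Gamma (n + 2 * α + 2 * β) /
        (√Real.pi * (n + α + β) ^ (2 * α) * Real.Gamma (2 * n + 2 * α + 2 * β)) <
      2 ^ (1 - α - β) := by
  have hn' : (0 : ℝ) < n := by exact_mod_cast hn
  have hα0 := hα.1
  have hα1 := hα.2
  have hN : 0 < n + α + β := by positivity
  have g1 := Real.Gamma_pos_of_pos hN
  have g2 := Real.Gamma_pos_of_pos (by positivity : 0 < n + α + β + 1 / 2)
  rw [gamma_bound_eq hα.1 hβ hn]
  refine mul_lt_of_lt_one_right (by positivity) ((div_lt_one (by positivity)).2 ?_)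
  refine Gamma_mul_Gamma_lt hN (by linarith) (by linarith) (by linarith) (fun h => hv ?_)
    (fun h => ⟨?_, ?_⟩)
  · exact ⟨Or.inr (by linarith), Or.inl (by linarith)⟩
  · by_contra! hcon
    exact hv ⟨Or.inl (by linarith), Or.inl (by linarith)⟩
  · by_contra! hcon
    exact hv ⟨Or.inr (by linarith), Or.inr (by linarith)⟩

theorem widomFactor_le_gamma_bound (ρa ρb : ℝ)
    (hρa : ρa ∈ Set.Icc (0 : ℝ) (1 / 2)) (hρb : ρb ∈ Set.Icc (0 : ℝ) (1 / 2))
    (r : ℝ) (hr : r = 2 * max ρa ρb) :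
    ∀ n : ℕ, 1 ≤ n →
      widomFactor ρa ρb n ≤
          (2 : ℝ) ^ (2 * (n : ℝ) + ρa + ρb) * Real.Gamma ((n : ℝ) + r + 1 / 2) *
              Real.Gamma ((n : ℝ) + 2 * ρa + 2 * ρb) /
            (Real.sqrt Real.pi * ((n : ℝ) + ρa + ρb) ^ r *
              Real.Gamma (2 * (n : ℝ) + 2 * ρa + 2 * ρb)) ∧
        (2 : ℝ) ^ (2 * (n : ℝ) + ρa + ρb) * Real.Gamma ((n : ℝ) + r + 1 / 2) *
              Real.Gamma ((n : ℝ) + 2 * ρa + 2 * ρb) /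
            (Real.sqrt Real.pi * ((n : ℝ) + ρa + ρb) ^ r *
              Real.Gamma (2 * (n : ℝ) + 2 * ρa + 2 * ρb)) ≤
          (2 : ℝ) ^ (1 - ρa - ρb) ∧
        (¬ ((ρa = 0 ∨ ρa = 1 / 2) ∧ (ρb = 0 ∨ ρb = 1 / 2)) →
          (2 : ℝ) ^ (2 * (n : ℝ) + ρa + ρb) * Real.Gamma ((n : ℝ) + r + 1 / 2) *
              Real.Gamma ((n : ℝ) + 2 * ρa + 2 * ρb) /
            (Real.sqrt Real.pi * ((n : ℝ) + ρa + ρb) ^ r *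
              Real.Gamma (2 * (n : ℝ) + 2 * ρa + 2 * ρb)) <
          (2 : ℝ) ^ (1 - ρa - ρb)) := by
  intro n hn
  rcases le_total ρb ρa with h | h
  · rw [max_eq_left h] at hr
    subst hr
    refine ⟨widomFactor_le_of_jacobi_bound (c := -(1 / 2)) (d := 1 / 2) hρa.1 hρb.1 hρa hρb hn
      (by rw [abs_neg, abs_of_pos (by norm_num)]) (fun y hy => ?_),
      gamma_bound_le hρa hρb.1 h hn, gamma_bound_lt hρa hρb.1 h hn⟩
    rw [(by ring : -(1 / 2) * y + 1 / 2 = (1 - y) / 2)]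
    exact rpow_mul_abs_jacobiPoly_le hρa hρb hn hy
  · rw [max_eq_right h] at hr
    subst hr
    rw [add_right_comm (2 * (n : ℝ)) ρa, add_right_comm (n : ℝ) (2 * ρa), add_right_comm (n : ℝ) ρa,
      add_right_comm (2 * (n : ℝ)) (2 * ρa), sub_right_comm, and_comm (b := ρb = 0 ∨ ρb = 1 / 2)]
    refine ⟨widomFactor_le_of_jacobi_bound (c := 1 / 2) (d := 1 / 2) hρa.1 hρb.1 hρb hρa hn
      (abs_of_pos (by norm_num)) (fun y hy => ?_),
      gamma_bound_le hρb hρa.1 h hn, gamma_bound_lt hρb hρa.1 h hn⟩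
    have := rpow_mul_abs_jacobiPoly_le (y := -y) hρb hρa hn ⟨by linarith [hy.2], by linarith [hy.1]⟩
    rw [sub_neg_eq_add, ← sub_eq_add_neg, mul_comm ((1 + y) ^ ρb)] at this
    rwa [(by ring : 1 / 2 * y + 1 / 2 = (1 + y) / 2)]
end
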